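/- arXiv:2211.00289 — 3 statements merged into one kernel-verified Lean document; each statement's English description precedes it below -/
import Mathlib

section
/- Let ν be a strongly Rayleigh function on the ℓ-element subsets of {1,…,n}, let V ⊆ {1,…,n}, let ζ ≥ 1, and let U be an ℓ-element ζ-approximate local optimum of ν inside V with ν(U) ≠ 0. Then for every ℓ-element set W ⊆ {1,…,n} and every e ∈ W∖U: ν(W)·ν(U) ≤ ℓ·Σ_{j∈U∖W} ν((W∖{e})∪{j})·ν((U∪{e})∖{j}). Moreover, if additionally e ∈ V, then ν(W) ≤ ζℓ·Σ_{j∈U∖W} ν((W∖{e})∪{j}) ≤ (ζℓ)²·max_{j∈U∖W} ν((W∖{e})∪{j}). -/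
open Finset

/-- A function `ν` assigning a nonnegative real to each `ℓ`-element subset of `{1,…,n}`
is strongly Rayleigh if its generating polynomial
`g_ν(z) = Σ_{|S|=ℓ} ν(S)·Π_{i∈S} z_i` has no complex zero with all coordinates in the
open upper half plane. -/
def StronglyRayleigh (n ℓ : ℕ) (ν : Finset (Fin n) → ℝ) : Prop :=
  (∀ S : Finset (Fin n), S.card = ℓ → 0 ≤ ν S) ∧
  ∀ z : Fin n → ℂ, (∀ i, 0 < (z i).im) →
    (∑ S ∈ Finset.powersetCard ℓ (Finset.univ : Finset (Fin n)),
      (ν S : ℂ) * ∏ i ∈ S, z i) ≠ 0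

/-- An `ℓ`-element set `U ⊆ V` is a `ζ`-approximate local optimum of `ν` inside `V` if
`ζ·ν(U) ≥ ν((U∖{e})∪{f})` for every `e ∈ U` and `f ∈ V∖U`. -/
def ApproxLocalOpt (n ℓ : ℕ) (ζ : ℝ) (ν : Finset (Fin n) → ℝ)
    (V U : Finset (Fin n)) : Prop :=
  U ⊆ V ∧ U.card = ℓ ∧
    ∀ e ∈ U, ∀ f ∈ V \ U, ν (insert f (U.erase e)) ≤ ζ * ν U

open Polynomial in
/-- If `p / q` maps the upper half plane to its closure, its derivative is nonnegative on the
real line. -/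
lemma wronskian_nonneg_of_im_nonneg (p q : ℝ[X])
    (h : ∀ s : ℂ, 0 < s.im → 0 ≤ (aeval s p * starRingEnd ℂ (aeval s q)).im) (x : ℝ) :
    0 ≤ p.derivative.eval x * q.eval x - p.eval x * q.derivative.eval x := by
  have conj_aeval (s : ℂ) : starRingEnd ℂ (aeval s q) = aeval (starRingEnd ℂ s) q :=
    (aeval_conj q s).symm
  have aeval_real (r : ℝ[X]) : aeval (x : ℂ) r = ((r.eval x : ℝ) : ℂ) := by
    simpa using aeval_algebraMap_apply ℂ x r
  have hup : HasDerivAt (fun y : ℝ => (x : ℂ) + y * Complex.I) Complex.I 0 := by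
    simpa using ((Complex.ofRealCLM.hasDerivAt (x := (0 : ℝ))).mul_const Complex.I).const_add
      (x : ℂ)
  have hdown : HasDerivAt (fun y : ℝ => (x : ℂ) - y * Complex.I) (-Complex.I) 0 := by
    simpa using ((Complex.ofRealCLM.hasDerivAt (x := (0 : ℝ))).mul_const Complex.I).const_sub
      (x : ℂ)
  have hp : HasDerivAt (fun y : ℝ => aeval ((x : ℂ) + y * Complex.I) p)
      (aeval (x : ℂ) p.derivative * Complex.I) 0 :=
    HasDerivAt.comp (h₂ := fun s : ℂ => aeval s p) (0 : ℝ)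
      (by simpa using p.hasDerivAt_aeval (x : ℂ)) hup
  have hq : HasDerivAt (fun y : ℝ => aeval ((x : ℂ) - y * Complex.I) q)
      (aeval (x : ℂ) q.derivative * -Complex.I) 0 :=
    HasDerivAt.comp (h₂ := fun s : ℂ => aeval s q) (0 : ℝ)
      (by simpa using q.hasDerivAt_aeval (x : ℂ)) hdown
  have him := Complex.imCLM.hasFDerivAt.comp_hasDerivAt (0 : ℝ) (hp.mul hq)
  have hnonneg := ge_of_tendsto him.tendsto_slope_zero_right (b := 0) <| by
    filter_upwards [self_mem_nhdsWithin] with y hy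
    have hy : 0 < y := hy
    have hs := h ((x : ℂ) + y * Complex.I) (by simpa using hy)
    rw [conj_aeval] at hs
    have hc : starRingEnd ℂ ((x : ℂ) + y * Complex.I) = x - y * Complex.I := by
      simp [sub_eq_add_neg]
    rw [hc] at hs
    have h0 : (aeval (x : ℂ) p * aeval (x : ℂ) q).im = 0 := by
      rw [aeval_real, aeval_real, ← Complex.ofReal_mul, Complex.ofReal_im]
    simp only [Function.comp_apply, Pi.mul_apply, Complex.imCLM_apply, zero_add,
      Complex.ofReal_zero, zero_mul, add_zero, sub_zero, h0, smul_eq_mul]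
    exact mul_nonneg (inv_nonneg.2 hy.le) hs
  simp only [Complex.imCLM_apply, aeval_real, Complex.ofReal_zero, zero_mul, add_zero,
    sub_zero] at hnonneg
  simp at hnonneg
  linarith

open Polynomial in
lemma eval_mul_eval_le_of_im_nonneg (p q : ℝ[X])
    (h : ∀ s : ℂ, 0 < s.im → 0 ≤ (aeval s p * starRingEnd ℂ (aeval s q)).im)
    (hq : ∀ t : ℝ, 0 ≤ t → 0 < q.eval t) :
    p.eval 0 * q.eval 1 ≤ p.eval 1 * q.eval 0 := by
  have hmono : MonotoneOn (fun t => p.eval t / q.eval t) (Set.Ici (0 : ℝ)) := by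
    refine monotoneOn_of_hasDerivWithinAt_nonneg (convex_Ici 0)
      (f' := fun x => (p.derivative.eval x * q.eval x - p.eval x * q.derivative.eval x) /
        q.eval x ^ 2) ?_ ?_ ?_
    · exact p.continuous.continuousOn.div q.continuous.continuousOn fun t ht => (hq t ht).ne'
    · intro x hx
      exact ((p.hasDerivAt x).div (q.hasDerivAt x)
        (hq x (interior_subset hx)).ne').hasDerivWithinAt
    · intro x _
      exact div_nonneg (wronskian_nonneg_of_im_nonneg p q h x) (sq_nonneg _)
  have := hmono (Set.mem_Ici.2 le_rfl) (Set.mem_Ici.2 zero_le_one) zero_le_one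
  rwa [div_le_div_iff₀ (hq 0 le_rfl) (hq 1 zero_le_one)] at this

/-- The multiaffine polynomial in the variables `z i`, `i ∈ E`, with coefficients `c`. -/
def multiaffine {ι K : Type*} [CommSemiring K] (E : Finset ι) (c : Finset ι → K) (z : ι → K) : K :=
  ∑ S ∈ E.powerset, c S * ∏ i ∈ S, z i

lemma map_multiaffine {ι K L : Type*} [CommSemiring K] [CommSemiring L] (f : K →+* L)
    (E : Finset ι) (c : Finset ι → K) (z : ι → K) :
    f (multiaffine E c z) = multiaffine E (fun S => f (c S)) (fun i => f (z i)) := by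
  simp [multiaffine]

lemma multiaffine_pos {ι : Type*} {E S : Finset ι} {c : Finset ι → ℝ} {z : ι → ℝ}
    (hc : ∀ S ⊆ E, 0 ≤ c S) (hS : S ⊆ E) (hcS : 0 < c S) (hz : ∀ i, 0 < z i) :
    0 < multiaffine E c z :=
  Finset.sum_pos' (fun T hT => mul_nonneg (hc T (Finset.mem_powerset.1 hT)) (Finset.prod_nonneg fun i _ => (hz i).le))
    ⟨S, Finset.mem_powerset.2 hS, mul_pos hcS (Finset.prod_pos fun i _ => hz i)⟩

lemma im_mul_conj_nonneg_of_forall_add_mul_ne_zero {a b : ℂ}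
    (h : ∀ w : ℂ, 0 < w.im → a + w * b ≠ 0) : 0 ≤ (a * starRingEnd ℂ b).im := by
  by_contra! hneg
  have hb : b ≠ 0 := by
    rintro rfl
    simp at hneg
  refine h (-(a / b)) ?_ (by field_simp; ring)
  have : (a / b).im = (a * starRingEnd ℂ b).im / Complex.normSq b := by
    rw [Complex.div_im, Complex.mul_im, Complex.conj_re, Complex.conj_im]
    ring
  rw [Complex.neg_im, this, Left.neg_pos_iff]
  exact div_neg_of_neg_of_pos hneg (Complex.normSq_pos.2 hb)

/-- If `A + w B` is stable, then `A / B` is nondecreasing in each variable on the positive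
orthant. -/
lemma multiaffine_mul_le_of_stable {ι : Type*} (E : Finset ι) {a b : Finset ι → ℝ}
    (h : ∀ (w : ℂ) (z : ι → ℂ), 0 < w.im → (∀ i, 0 < (z i).im) →
      multiaffine E (fun S => (a S : ℂ)) z + w * multiaffine E (fun S => (b S : ℂ)) z ≠ 0)
    (hb : ∀ z : ι → ℝ, (∀ i, 0 < z i) → 0 < multiaffine E b z)
    {x y : ι → ℝ} (hx : ∀ i, 0 < x i) (hxy : ∀ i, x i ≤ y i) :
    multiaffine E a x * multiaffine E b y ≤ multiaffine E a y * multiaffine E b x := by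
  have hclosed (z : ι → ℂ) (hz : ∀ i, 0 ≤ (z i).im) :
      0 ≤ (multiaffine E (fun S => (a S : ℂ)) z *
        starRingEnd ℂ (multiaffine E (fun S => (b S : ℂ)) z)).im := by
    have hcont : Continuous fun δ : ℝ =>
        (multiaffine E (fun S => (a S : ℂ)) (fun i => z i + δ * Complex.I) *
        starRingEnd ℂ (multiaffine E (fun S => (b S : ℂ)) (fun i => z i + δ * Complex.I))).im := by
      unfold multiaffine
      fun_prop
    have hlim := (hcont.tendsto 0).mono_left (nhdsWithin_le_nhds (s := Set.Ioi 0))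
    simp only [Complex.ofReal_zero, zero_mul, add_zero] at hlim
    refine ge_of_tendsto hlim ?_
    filter_upwards [self_mem_nhdsWithin] with δ hδ
    have hδ : 0 < δ := hδ
    refine im_mul_conj_nonneg_of_forall_add_mul_ne_zero fun w hw => h w _ hw fun i => ?_
    have := hz i
    simp
    linarith
  let line (c : Finset ι → ℝ) : Polynomial ℝ :=
    multiaffine E (fun S => Polynomial.C (c S))
      (fun i => Polynomial.C (x i) + Polynomial.C (y i - x i) * Polynomial.X)
  have eval_line (c : Finset ι → ℝ) (t : ℝ) :
      (line c).eval t = multiaffine E c (fun i => x i + (y i - x i) * t) := by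
    have := map_multiaffine (Polynomial.evalRingHom t) E (fun S => Polynomial.C (c S))
      (fun i => Polynomial.C (x i) + Polynomial.C (y i - x i) * Polynomial.X)
    simpa [line] using this
  have aeval_line (c : Finset ι → ℝ) (s : ℂ) :
      Polynomial.aeval s (line c) =
        multiaffine E (fun S => (c S : ℂ)) (fun i => x i + ((y i - x i : ℝ) : ℂ) * s) := by
    have := map_multiaffine (Polynomial.aeval (R := ℝ) s).toRingHom E
      (fun S => Polynomial.C (c S))
      (fun i => Polynomial.C (x i) + Polynomial.C (y i - x i) * Polynomial.X)
    simpa [line] using this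
  have hmain := eval_mul_eval_le_of_im_nonneg (line a) (line b) (fun s hs => by
      rw [aeval_line, aeval_line]
      refine hclosed _ fun i => ?_
      have := mul_nonneg (sub_nonneg.2 (hxy i)) hs.le
      simpa using this) (fun t ht => by
      rw [eval_line]
      exact hb _ fun i => add_pos_of_pos_of_nonneg (hx i)
        (mul_nonneg (sub_nonneg.2 (hxy i)) ht))
  simpa [eval_line] using hmain

/-- The multihomogenization of `multiaffine E c`. -/
def multihom {ι : Type*} [DecidableEq ι] (E : Finset ι) (c : Finset ι → ℝ) (u v : ι → ℝ) : ℝ :=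
  ∑ S ∈ E.powerset, c S * ∏ i ∈ E, if i ∈ S then u i else v i

lemma multihom_eq {ι : Type*} [DecidableEq ι] (E : Finset ι) (c : Finset ι → ℝ) {u v : ι → ℝ}
    (hv : ∀ i, v i ≠ 0) :
    multihom E c u v = (∏ i ∈ E, v i) * multiaffine E c (fun i => u i / v i) := by
  rw [multihom, multiaffine, Finset.mul_sum]
  refine Finset.sum_congr rfl fun S hS => ?_
  have hS : S ⊆ E := Finset.mem_powerset.1 hS
  have hprod : ∏ i ∈ S, u i / v i = ∏ i ∈ E, if i ∈ S then u i / v i else 1 := by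
    rw [Finset.prod_ite_mem, Finset.inter_eq_right.2 hS]
  rw [hprod, mul_left_comm, ← Finset.prod_mul_distrib]
  congr 1
  refine Finset.prod_congr rfl fun i _ => ?_
  split_ifs
  · rw [mul_div_cancel₀ _ (hv i)]
  · rw [mul_one]

lemma multihom_mul_le_of_stable {ι : Type*} [DecidableEq ι] (E : Finset ι) {a b : Finset ι → ℝ}
    (h : ∀ (w : ℂ) (z : ι → ℂ), 0 < w.im → (∀ i, 0 < (z i).im) →
      multiaffine E (fun S => (a S : ℂ)) z + w * multiaffine E (fun S => (b S : ℂ)) z ≠ 0)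
    (hb : ∀ z : ι → ℝ, (∀ i, 0 < z i) → 0 < multiaffine E b z)
    {u v u' v' : ι → ℝ} (hu : ∀ i, 0 < u i) (hv : ∀ i, 0 < v i) (hv' : ∀ i, 0 < v' i)
    (huv : ∀ i, u i * v' i ≤ u' i * v i) :
    multihom E a u v * multihom E b u' v' ≤ multihom E a u' v' * multihom E b u v := by
  have hmain := multiaffine_mul_le_of_stable E h hb (x := fun i => u i / v i)
    (y := fun i => u' i / v' i) (fun i => div_pos (hu i) (hv i))
    (fun i => (div_le_div_iff₀ (hv i) (hv' i)).2 (huv i))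
  rw [multihom_eq E a fun i => (hv i).ne', multihom_eq E b fun i => (hv i).ne',
    multihom_eq E a fun i => (hv' i).ne', multihom_eq E b fun i => (hv' i).ne']
  have hpos : 0 ≤ (∏ i ∈ E, v i) * ∏ i ∈ E, v' i :=
    mul_nonneg (Finset.prod_nonneg fun i _ => (hv i).le) (Finset.prod_nonneg fun i _ => (hv' i).le)
  have := mul_le_mul_of_nonneg_left hmain hpos
  linarith

/-- Numerators of weights that tend to `1` on `C`, to `w` on `D` and to `0` elsewhere. -/
def faceNum {ι : Type*} [DecidableEq ι] (C D : Finset ι) (w : ι → ℝ) (ε : ℝ) (i : ι) : ℝ :=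
  if i ∈ C then 1 else if i ∈ D then w i else ε

/-- Denominators of weights that tend to `0` on `C` and to `1` elsewhere. -/
def faceDen {ι : Type*} [DecidableEq ι] (C : Finset ι) (ε : ℝ) (i : ι) : ℝ :=
  if i ∈ C then ε else 1

lemma continuous_multihom_face {ι : Type*} [DecidableEq ι] (E C D : Finset ι)
    (c : Finset ι → ℝ) (w : ι → ℝ) :
    Continuous fun ε => multihom E c (faceNum C D w ε) (faceDen C ε) := by
  unfold multihom
  refine continuous_finsetSum _ fun S _ => continuous_const.mul ?_
  refine continuous_finsetProd _ fun i _ => ?_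
  unfold faceNum faceDen
  split_ifs <;> fun_prop

lemma multihom_face_zero {ι : Type*} [DecidableEq ι] {E C D : Finset ι} (hC : C ⊆ E)
    (hD : D ⊆ E) (hCD : Disjoint C D) (c : Finset ι → ℝ) (w : ι → ℝ) :
    multihom E c (faceNum C D w 0) (faceDen C 0) =
      ∑ T ∈ D.powerset, c (C ∪ T) * ∏ i ∈ T, w i := by
  have hinj : Set.InjOn (fun T => C ∪ T) (D.powerset : Set (Finset ι)) := by
    intro S hS T hT hST
    have hS : S ⊆ D := by simpa using hS
    have hT : T ⊆ D := by simpa using hT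
    have h1 := Finset.union_sdiff_cancel_left (hCD.mono_right hS)
    have h2 := Finset.union_sdiff_cancel_left (hCD.mono_right hT)
    have hST : C ∪ S = C ∪ T := hST
    rw [← h1, ← h2, hST]
  unfold multihom
  symm
  refine Finset.sum_of_injOn (fun T => C ∪ T) hinj ?_ ?_ ?_
  · intro T hT
    have hT : T ⊆ D := by simpa using hT
    exact Finset.mem_coe.2 (Finset.mem_powerset.2 (Finset.union_subset hC (hT.trans hD)))
  · intro S hS hSim
    have hS : S ⊆ E := Finset.mem_powerset.1 hS
    refine mul_eq_zero_of_right _ ?_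
    by_cases hCS : C ⊆ S
    · by_cases hSD : S ⊆ C ∪ D
      · refine absurd ⟨S \ C, ?_, Finset.union_sdiff_of_subset hCS⟩ hSim
        exact Finset.mem_coe.2 (Finset.mem_powerset.2 (sdiff_le_iff.2 hSD))
      · obtain ⟨i, hiS, hi⟩ := Finset.not_subset.1 hSD
        refine Finset.prod_eq_zero (hS hiS) ?_
        simp only [Finset.mem_union, not_or] at hi
        simp [faceNum, hiS, hi.1, hi.2]
    · obtain ⟨i, hiC, hi⟩ := Finset.not_subset.1 hCS
      exact Finset.prod_eq_zero (hC hiC) (by simp [faceDen, hiC, hi])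
  · intro T hT
    have hT : T ⊆ D := Finset.mem_powerset.1 hT
    congr 1
    have : ∏ i ∈ T, w i = ∏ i ∈ E, if i ∈ T then w i else 1 := by
      rw [Finset.prod_ite_mem, Finset.inter_eq_right.2 (hT.trans hD)]
    rw [this]
    refine Finset.prod_congr rfl fun i _ => ?_
    have hdisj : i ∈ C → i ∉ D := fun h => Finset.disjoint_left.1 hCD h
    have hTD := @hT i
    by_cases h1 : i ∈ C <;> by_cases h2 : i ∈ T <;> by_cases h3 : i ∈ D <;>
      simp_all [faceNum, faceDen]

lemma sum_powersetCard_card_sub_one {ι M : Type*} [DecidableEq ι] [AddCommMonoid M]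
    (D : Finset ι) (hD : D.Nonempty) (f : Finset ι → M) :
    ∑ T ∈ Finset.powersetCard (D.card - 1) D, f T = ∑ j ∈ D, f (D.erase j) := by
  symm
  refine Finset.sum_of_injOn D.erase (Finset.erase_injOn D) ?_ ?_ fun _ _ => rfl
  · intro j hj
    have hj : j ∈ D := hj
    simp [Finset.mem_powersetCard, Finset.erase_subset, Finset.card_erase_of_mem hj]
  · intro T hT hTim
    obtain ⟨hTD, hcard⟩ := Finset.mem_powersetCard.1 hT
    have hpos := hD.card_pos
    have h1 : (D \ T).card = 1 := by
      rw [Finset.card_sdiff_of_subset hTD]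
      omega
    obtain ⟨j, hj⟩ := Finset.card_eq_one.1 h1
    have hjD : j ∈ D := (Finset.mem_sdiff.1 (hj ▸ Finset.mem_singleton_self j)).1
    refine absurd ⟨j, hjD, ?_⟩ hTim
    rw [Finset.erase_eq, ← hj, Finset.sdiff_sdiff_eq_self hTD]

lemma sum_powerset_union_ite_card {ι : Type*} [DecidableEq ι] {C D : Finset ι}
    (hCD : Disjoint C D) {k m : ℕ} (hm : C.card + m = k) (f : Finset ι → ℝ) (w : ι → ℝ) :
    ∑ T ∈ D.powerset, (if (C ∪ T).card = k then f (C ∪ T) else 0) * ∏ i ∈ T, w i =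
      ∑ T ∈ Finset.powersetCard m D, f (C ∪ T) * ∏ i ∈ T, w i := by
  rw [Finset.powersetCard_eq_filter, Finset.sum_filter]
  refine Finset.sum_congr rfl fun T hT => ?_
  have hT : T ⊆ D := Finset.mem_powerset.1 hT
  have hcard : (C ∪ T).card = k ↔ T.card = m := by
    rw [Finset.card_union_of_disjoint (hCD.mono_right hT)]
    omega
  by_cases h : T.card = m <;> simp [hcard, h]

lemma sum_powersetCard_univ_eq_multiaffine {n : ℕ} (ℓ : ℕ) (ν : Finset (Fin n) → ℝ) (e : Fin n)
    (z : Fin n → ℂ) :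
    ∑ S ∈ Finset.powersetCard ℓ (Finset.univ : Finset (Fin n)), (ν S : ℂ) * ∏ i ∈ S, z i =
      multiaffine (Finset.univ.erase e)
        (fun S => ((if S.card = ℓ then ν S else 0 : ℝ) : ℂ)) z +
      z e * multiaffine (Finset.univ.erase e)
        (fun S => ((if S.card + 1 = ℓ then ν (insert e S) else 0 : ℝ) : ℂ)) z := by
  have he : e ∉ (Finset.univ : Finset (Fin n)).erase e := Finset.notMem_erase e _
  rw [Finset.powersetCard_eq_filter, Finset.sum_filter,
    ← Finset.insert_erase (Finset.mem_univ e), Finset.sum_powerset_insert he,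
    Finset.insert_erase (Finset.mem_univ e)]
  unfold multiaffine
  rw [Finset.mul_sum]
  congr 1
  · refine Finset.sum_congr rfl fun S _ => ?_
    by_cases h : S.card = ℓ <;> simp [h]
  · refine Finset.sum_congr rfl fun S hS => ?_
    have heS : e ∉ S := fun h => he (Finset.mem_powerset.1 hS h)
    rw [Finset.card_insert_of_notMem heS, Finset.prod_insert heS]
    by_cases h : S.card + 1 = ℓ
    · simp only [h, if_true]
      ring
    · simp [h]

lemma StronglyRayleigh.multiaffine_add_mul_ne_zero {n ℓ : ℕ} {ν : Finset (Fin n) → ℝ}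
    (hν : StronglyRayleigh n ℓ ν) (e : Fin n) (w : ℂ) (z : Fin n → ℂ) (hw : 0 < w.im)
    (hz : ∀ i, 0 < (z i).im) :
    multiaffine (Finset.univ.erase e)
        (fun S => ((if S.card = ℓ then ν S else 0 : ℝ) : ℂ)) z +
      w * multiaffine (Finset.univ.erase e)
        (fun S => ((if S.card + 1 = ℓ then ν (insert e S) else 0 : ℝ) : ℂ)) z ≠ 0 := by
  have hne := hν.2 (Function.update z e w) fun i => by
    rcases eq_or_ne i e with rfl | hi
    · simpa using hw
    · simpa [hi] using hz i
  rw [sum_powersetCard_univ_eq_multiaffine ℓ ν e] at hne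
  have hcongr (c : Finset (Fin n) → ℂ) :
      multiaffine (Finset.univ.erase e) c (Function.update z e w) =
        multiaffine (Finset.univ.erase e) c z := by
    refine Finset.sum_congr rfl fun S hS => ?_
    congr 1
    refine Finset.prod_congr rfl fun i hi => ?_
    have : i ≠ e := Finset.ne_of_mem_erase (Finset.mem_powerset.1 hS hi)
    simp [this]
  rwa [hcongr, hcongr, Function.update_self] at hne

lemma StronglyRayleigh.weighted_exchange {n ℓ : ℕ} {ν : Finset (Fin n) → ℝ}
    (hν : StronglyRayleigh n ℓ ν) {U W : Finset (Fin n)} (hU : U.card = ℓ) (hW : W.card = ℓ)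
    {e : Fin n} (heW : e ∈ W) (heU : e ∉ U) (w : Fin n → ℝ) (hw : ∀ i, 0 < w i) :
    ν W * ν U ≤ (∑ j ∈ U \ W, ν (insert j (W.erase e)) * w j) *
      ∑ j ∈ U \ W, ν ((insert e U).erase j) / w j := by
  have hnonneg : 0 ≤ (∑ j ∈ U \ W, ν (insert j (W.erase e)) * w j) *
      ∑ j ∈ U \ W, ν ((insert e U).erase j) / w j := by
    refine mul_nonneg (Finset.sum_nonneg fun j hj => mul_nonneg (hν.1 _ ?_) (hw j).le)
      (Finset.sum_nonneg fun j hj => div_nonneg (hν.1 _ ?_) (hw j).le)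
    · have hj := (Finset.mem_sdiff.1 hj).2
      rw [Finset.card_insert_of_notMem (fun h => hj (Finset.mem_of_mem_erase h)),
        Finset.card_erase_add_one heW, hW]
    · have hj := (Finset.mem_sdiff.1 hj).1
      rw [Finset.card_erase_of_mem (Finset.mem_insert_of_mem hj),
        Finset.card_insert_of_notMem heU, hU, Nat.add_sub_cancel]
  rcases (hν.1 W hW).eq_or_lt with hW0 | hWpos
  · rwa [← hW0, zero_mul]
  set E : Finset (Fin n) := Finset.univ.erase e with hE
  set D := U \ W with hD
  set a : Finset (Fin n) → ℝ := fun S => if S.card = ℓ then ν S else 0 with ha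
  set b : Finset (Fin n) → ℝ := fun S => if S.card + 1 = ℓ then ν (insert e S) else 0 with hb
  have hcardW : (W.erase e).card + 1 = ℓ := by rw [Finset.card_erase_add_one heW, hW]
  have hUE : U ⊆ E := fun i hi =>
    Finset.mem_erase.2 ⟨fun h => heU (h ▸ hi), Finset.mem_univ i⟩
  have hWE : W.erase e ⊆ E := Finset.erase_subset_erase e (Finset.subset_univ W)
  have hDE : D ⊆ E := Finset.sdiff_subset.trans hUE
  have hCE : U ∩ W ⊆ E := Finset.inter_subset_left.trans hUE
  have hCD : Disjoint (U ∩ W) D := (Finset.disjoint_sdiff_inter U W).symm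
  have hWD : Disjoint (W.erase e) D :=
    Finset.disjoint_sdiff.mono_left (Finset.erase_subset e W)
  have hcardC : (U ∩ W).card + D.card = ℓ := by
    rw [← hU, add_comm]
    exact Finset.card_sdiff_add_card_inter U W
  have hDne : D.Nonempty := by
    rw [hD, Finset.sdiff_nonempty]
    intro hUW
    exact heU (Finset.eq_of_subset_of_card_le hUW (by omega) ▸ heW)
  have hDpos := hDne.card_pos
  have hbpos (z : Fin n → ℝ) (hz : ∀ i, 0 < z i) : 0 < multiaffine E b z := by
    refine multiaffine_pos (S := W.erase e) (fun S hS => ?_) hWE ?_ hz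
    · have heS : e ∉ S := fun h => Finset.notMem_erase e _ (hS h)
      simp only [hb]
      split_ifs with hcard
      · exact hν.1 _ (by rw [Finset.card_insert_of_notMem heS, hcard])
      · exact le_rfl
    · simpa [hb, hcardW, Finset.insert_erase heW] using hWpos
  have hpos_num (C : Finset (Fin n)) (ε : ℝ) (hε : 0 < ε) (i : Fin n) :
      0 < faceNum C D w ε i := by
    unfold faceNum
    split_ifs
    exacts [one_pos, hw i, hε]
  have hpos_den (C : Finset (Fin n)) (ε : ℝ) (hε : 0 < ε) (i : Fin n) :
      0 < faceDen C ε i := by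
    unfold faceDen
    split_ifs
    exacts [hε, one_pos]
  have hface (ε : ℝ) (hε : 0 < ε) (hε1 : ε < 1) :
      multihom E a (faceNum (U ∩ W) D w ε) (faceDen (U ∩ W) ε) *
        multihom E b (faceNum (W.erase e) D w ε) (faceDen (W.erase e) ε) ≤
      multihom E a (faceNum (W.erase e) D w ε) (faceDen (W.erase e) ε) *
        multihom E b (faceNum (U ∩ W) D w ε) (faceDen (U ∩ W) ε) := by
    refine multihom_mul_le_of_stable E (hν.multiaffine_add_mul_ne_zero e) hbpos
      (hpos_num _ ε hε) (hpos_den _ ε hε) (hpos_den _ ε hε) fun i => ?_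
    have hie : i = e → i ∉ U := fun h => h ▸ heU
    have hεε : ε * ε ≤ 1 := by nlinarith
    by_cases h1 : i ∈ U <;> by_cases h2 : i ∈ W <;> by_cases h3 : i = e <;>
      simp_all [faceNum, faceDen]
  have hlim : multihom E a (faceNum (U ∩ W) D w 0) (faceDen (U ∩ W) 0) *
        multihom E b (faceNum (W.erase e) D w 0) (faceDen (W.erase e) 0) ≤
      multihom E a (faceNum (W.erase e) D w 0) (faceDen (W.erase e) 0) *
        multihom E b (faceNum (U ∩ W) D w 0) (faceDen (U ∩ W) 0) := by
    have hcont (c : Finset (Fin n) → ℝ) (C : Finset (Fin n)) :=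
      ((continuous_multihom_face E C D c w).tendsto 0).mono_left
        (nhdsWithin_le_nhds (s := Set.Ioi 0))
    refine le_of_tendsto_of_tendsto ((hcont _ _).mul (hcont _ _)) ((hcont _ _).mul (hcont _ _)) ?_
    filter_upwards [Ioo_mem_nhdsGT (one_pos (α := ℝ))] with ε hε
    exact hface ε hε.1 hε.2
  have hbℓ (S : Finset (Fin n)) :
      b S = if S.card = ℓ - 1 then (fun S => ν (insert e S)) S else 0 := by
    have : S.card + 1 = ℓ ↔ S.card = ℓ - 1 := by omega
    simp only [hb, this]
  simp only [multihom_face_zero hCE hDE hCD, multihom_face_zero hWE hDE hWD, hbℓ, ha] at hlim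
  rw [sum_powerset_union_ite_card hCD (k := ℓ) hcardC ν,
    sum_powerset_union_ite_card hWD (k := ℓ - 1) (m := 0) (by omega)
      (fun S => ν (insert e S)),
    sum_powerset_union_ite_card hWD (k := ℓ) (m := 1) (by omega) ν,
    sum_powerset_union_ite_card hCD (k := ℓ - 1) (m := D.card - 1) (by omega)
      (fun S => ν (insert e S)),
    sum_powersetCard_card_sub_one D hDne, Finset.powersetCard_self, Finset.powersetCard_zero,
    Finset.powersetCard_one, Finset.sum_map] at hlim
  have hprod : 0 < ∏ i ∈ D, w i := Finset.prod_pos fun i _ => hw i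
  have hUD : U ∩ W ∪ D = U := by
    rw [Finset.union_comm]
    exact Finset.sdiff_union_inter U W
  have hleft : ∑ j ∈ D, ν (insert e (U ∩ W ∪ D.erase j)) * ∏ i ∈ D.erase j, w i =
      (∏ i ∈ D, w i) * ∑ j ∈ D, ν ((insert e U).erase j) / w j := by
    rw [Finset.mul_sum]
    refine Finset.sum_congr rfl fun j hj => ?_
    have hjC : j ∉ U ∩ W := Finset.disjoint_right.1 hCD hj
    have hje : e ≠ j := fun h => heU (h ▸ (Finset.mem_sdiff.1 hj).1)
    have hUj : U.erase j = U ∩ W ∪ D.erase j := by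
      conv_lhs => rw [← hUD, Finset.erase_union_distrib, Finset.erase_eq_of_notMem hjC]
    rw [← Finset.mul_prod_erase D w hj, Finset.erase_insert_of_ne hje, hUj]
    have := (hw j).ne'
    field_simp
  have hright : ∑ j ∈ D, ν (W.erase e ∪ {j}) * ∏ i ∈ {j}, w i =
      ∑ j ∈ D, ν (insert j (W.erase e)) * w j := by
    refine Finset.sum_congr rfl fun j _ => ?_
    rw [Finset.prod_singleton, Finset.union_comm, ← Finset.insert_eq]
  simp only [Finset.sum_singleton, Finset.union_empty, Finset.prod_empty, mul_one, hUD,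
    Finset.insert_erase heW, hleft, Function.Embedding.coeFn_mk, hright] at hlim
  refine le_of_mul_le_mul_left ?_ hprod
  linarith

lemma le_card_mul_sum_of_forall_weights {ι : Type*} (D : Finset ι) (p q : ι → ℝ)
    (hp : ∀ j ∈ D, 0 ≤ p j) (hq : ∀ j ∈ D, 0 ≤ q j) {M : ℝ}
    (h : ∀ w : ι → ℝ, (∀ i, 0 < w i) → M ≤ (∑ j ∈ D, p j * w j) * ∑ j ∈ D, q j / w j) :
    M ≤ D.card * ∑ j ∈ D, p j * q j := by
  have hε (ε : ℝ) (hε : 0 < ε) : M ≤ D.card * ∑ j ∈ D, (p j + ε) * (q j + ε) := by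
    set P : ι → ℝ := fun j => √(|p j| + ε) with hP
    set Q : ι → ℝ := fun j => √(|q j| + ε) with hQ
    have hPpos (j : ι) : 0 < P j := Real.sqrt_pos.2 (by positivity)
    have hQpos (j : ι) : 0 < Q j := Real.sqrt_pos.2 (by positivity)
    have hPsq (j) (hj : j ∈ D) : P j ^ 2 = p j + ε := by
      rw [hP, Real.sq_sqrt (by positivity), abs_of_nonneg (hp j hj)]
    have hQsq (j) (hj : j ∈ D) : Q j ^ 2 = q j + ε := by
      rw [hQ, Real.sq_sqrt (by positivity), abs_of_nonneg (hq j hj)]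
    have hp_le : ∑ j ∈ D, p j * (Q j / P j) ≤ ∑ j ∈ D, P j * Q j := by
      refine Finset.sum_le_sum fun j hj => ?_
      rw [← mul_div_assoc, div_le_iff₀ (hPpos j)]
      nlinarith [hPsq j hj, hQpos j]
    have hq_le : ∑ j ∈ D, q j / (Q j / P j) ≤ ∑ j ∈ D, P j * Q j := by
      refine Finset.sum_le_sum fun j hj => ?_
      rw [div_div_eq_mul_div, div_le_iff₀ (hQpos j)]
      nlinarith [hQsq j hj, hPpos j]
    have hPQ : 0 ≤ ∑ j ∈ D, P j * Q j :=
      Finset.sum_nonneg fun j _ => (mul_pos (hPpos j) (hQpos j)).le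
    calc M ≤ (∑ j ∈ D, p j * (Q j / P j)) * ∑ j ∈ D, q j / (Q j / P j) :=
          h _ fun j => div_pos (hQpos j) (hPpos j)
      _ ≤ (∑ j ∈ D, P j * Q j) * ∑ j ∈ D, P j * Q j :=
          mul_le_mul hp_le hq_le (Finset.sum_nonneg fun j hj =>
            div_nonneg (hq j hj) (div_pos (hQpos j) (hPpos j)).le) hPQ
      _ = (∑ j ∈ D, P j * Q j) ^ 2 := (sq _).symm
      _ ≤ D.card * ∑ j ∈ D, (P j * Q j) ^ 2 := sq_sum_le_card_mul_sum_sq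
      _ = D.card * ∑ j ∈ D, (p j + ε) * (q j + ε) := by
          congr 1
          exact Finset.sum_congr rfl fun j hj => by rw [mul_pow, hPsq j hj, hQsq j hj]
  have hcont : Continuous fun ε : ℝ => (D.card : ℝ) * ∑ j ∈ D, (p j + ε) * (q j + ε) := by
    fun_prop
  have hlim := (hcont.tendsto 0).mono_left (nhdsWithin_le_nhds (s := Set.Ioi 0))
  simp only [add_zero] at hlim
  refine ge_of_tendsto hlim ?_
  filter_upwards [self_mem_nhdsWithin] with ε h0
  exact hε ε h0

/-- the exchange inequality for strongly Rayleigh distributions, with the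
strengthened form for `e ∈ V` when `U` is a `ζ`-approximate local optimum inside `V`. -/
theorem stmt2 (n ℓ : ℕ) (hℓ1 : 1 ≤ ℓ) (hℓn : ℓ ≤ n)
    (ν : Finset (Fin n) → ℝ) (hν : StronglyRayleigh n ℓ ν)
    (V : Finset (Fin n)) (ζ : ℝ) (hζ : 1 ≤ ζ)
    (U : Finset (Fin n)) (hU : ApproxLocalOpt n ℓ ζ ν V U) (hUne : ν U ≠ 0)
    (W : Finset (Fin n)) (hW : W.card = ℓ)
    (e : Fin n) (heW : e ∈ W) (heU : e ∉ U) :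
    ν W * ν U ≤
      ℓ * ∑ j ∈ U \ W, ν (insert j (W.erase e)) * ν ((insert e U).erase j) ∧
    (e ∈ V →
      ν W ≤ ζ * ℓ * ∑ j ∈ U \ W, ν (insert j (W.erase e)) ∧
      ∃ j ∈ U \ W,
        ζ * ℓ * ∑ j' ∈ U \ W, ν (insert j' (W.erase e)) ≤
          (ζ * ℓ) ^ 2 * ν (insert j (W.erase e))) := by
  obtain ⟨hUV, hUcard, hUopt⟩ := hU
  have hUpos : 0 < ν U := lt_of_le_of_ne (hν.1 U hUcard) hUne.symm
  have hp (j) (hj : j ∈ U \ W) : 0 ≤ ν (insert j (W.erase e)) := hν.1 _ <| by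
    have hj := (Finset.mem_sdiff.1 hj).2
    rw [Finset.card_insert_of_notMem (fun h => hj (Finset.mem_of_mem_erase h)),
      Finset.card_erase_add_one heW, hW]
  have hq (j) (hj : j ∈ U \ W) : 0 ≤ ν ((insert e U).erase j) := hν.1 _ <| by
    have hj := (Finset.mem_sdiff.1 hj).1
    rw [Finset.card_erase_of_mem (Finset.mem_insert_of_mem hj),
      Finset.card_insert_of_notMem heU, hUcard, Nat.add_sub_cancel]
  have hcard : ((U \ W).card : ℝ) ≤ ℓ := by
    exact_mod_cast hUcard ▸ Finset.card_le_card (Finset.sdiff_subset (s := U) (t := W))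
  have hexch : ν W * ν U ≤
      ℓ * ∑ j ∈ U \ W, ν (insert j (W.erase e)) * ν ((insert e U).erase j) :=
    (le_card_mul_sum_of_forall_weights (U \ W) _ _ hp hq
      (hν.weighted_exchange hUcard hW heW heU)).trans
      (mul_le_mul_of_nonneg_right hcard
        (Finset.sum_nonneg fun j hj => mul_nonneg (hp j hj) (hq j hj)))
  refine ⟨hexch, fun heV => ⟨?_, ?_⟩⟩
  · refine le_of_mul_le_mul_right (hexch.trans ?_) hUpos
    have : ∑ j ∈ U \ W, ν (insert j (W.erase e)) * ν ((insert e U).erase j) ≤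
        ∑ j ∈ U \ W, ν (insert j (W.erase e)) * (ζ * ν U) := by
      refine Finset.sum_le_sum fun j hj => mul_le_mul_of_nonneg_left ?_ (hp j hj)
      have hjU := (Finset.mem_sdiff.1 hj).1
      rw [Finset.erase_insert_of_ne (fun h : e = j => heU (h ▸ hjU))]
      exact hUopt j hjU e (Finset.mem_sdiff.2 ⟨heV, heU⟩)
    rw [← Finset.sum_mul] at this
    calc _ ≤ (ℓ : ℝ) * ((∑ j ∈ U \ W, ν (insert j (W.erase e))) * (ζ * ν U)) :=
          mul_le_mul_of_nonneg_left this (Nat.cast_nonneg ℓ)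
      _ = _ := by ring
  · have hne : (U \ W).Nonempty := by
      rw [Finset.sdiff_nonempty]
      intro hUW
      exact heU (Finset.eq_of_subset_of_card_le hUW (by omega) ▸ heW)
    obtain ⟨j, hj, hmax⟩ := Finset.exists_max_image (U \ W) (fun j => ν (insert j (W.erase e))) hne
    refine ⟨j, hj, ?_⟩
    have hsum : ∑ j' ∈ U \ W, ν (insert j' (W.erase e)) ≤ ζ * ℓ * ν (insert j (W.erase e)) := by
      calc _ ≤ (U \ W).card • ν (insert j (W.erase e)) := Finset.sum_le_card_nsmul _ _ _ hmax
        _ = ((U \ W).card : ℝ) * ν (insert j (W.erase e)) := nsmul_eq_mul _ _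
        _ ≤ ζ * ℓ * ν (insert j (W.erase e)) := by
          refine mul_le_mul_of_nonneg_right ?_ (hp j hj)
          exact hcard.trans (le_mul_of_one_le_left (Nat.cast_nonneg ℓ) hζ)
    calc _ ≤ ζ * ℓ * (ζ * ℓ * ν (insert j (W.erase e))) :=
          mul_le_mul_of_nonneg_left hsum
            (mul_nonneg (zero_le_one.trans hζ) (Nat.cast_nonneg ℓ))
      _ = _ := by ring
end

section
/- Let ν be a strongly Rayleigh function on the ℓ-element subsets of {1,…,n} with full support, let ζ ≥ 1, let V ⊆ {1,…,n}, and let U be an ℓ-element ζ-approximate local optimum of ν inside V. Write φ(W) = (ζℓ)^{2|W∩U|}. Then for every integer k ≥ ℓ, every k-element set S ⊆ {1,…,n}, and every e ∈ (V∩S)∖U, there exists f ∈ U such that Σ_{W⊆S, |W|=ℓ} φ(W)·ν(W) ≤ Σ_{W⊆S, |W|=ℓ, e∉W} φ(W)·ν(W) + Σ_{W⊆S, |W|=ℓ, e∈W, f∉W} φ((W∖{e})∪{f})·ν((W∖{e})∪{f}). -/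
open Finset

section GeneratingPolynomial

variable {n : ℕ} {R : Type*} [CommRing R] [Algebra ℝ R]

/-- The generating polynomial of `ν`, evaluated in an arbitrary real algebra. -/
def genEval (ℓ : ℕ) (ν : Finset (Fin n) → ℝ) (z : Fin n → R) : R :=
  ∑ S ∈ powersetCard ℓ (univ : Finset (Fin n)), algebraMap ℝ R (ν S) * ∏ i ∈ S, z i

/-- The partial derivative in direction `e` of the generating polynomial of `ν`. -/
def genPartial (ℓ : ℕ) (ν : Finset (Fin n) → ℝ) (e : Fin n) (z : Fin n → R) : R :=
  ∑ S ∈ powersetCard ℓ (univ : Finset (Fin n)) with e ∈ S,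
    algebraMap ℝ R (ν S) * ∏ i ∈ S.erase e, z i

variable {ℓ : ℕ} {ν : Finset (Fin n) → ℝ}

lemma map_genEval {R' : Type*} [CommRing R'] [Algebra ℝ R'] (φ : R →ₐ[ℝ] R') (z : Fin n → R) :
    φ (genEval ℓ ν z) = genEval ℓ ν (fun i => φ (z i)) := by
  simp [genEval]

lemma map_genPartial {R' : Type*} [CommRing R'] [Algebra ℝ R'] (φ : R →ₐ[ℝ] R') (e : Fin n)
    (z : Fin n → R) :
    φ (genPartial ℓ ν e z) = genPartial ℓ ν e (fun i => φ (z i)) := by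
  simp [genPartial]

lemma genEval_smul (c : R) (z : Fin n → R) :
    genEval ℓ ν (fun i => c * z i) = c ^ ℓ * genEval ℓ ν z := by
  unfold genEval
  rw [mul_sum]
  refine sum_congr rfl fun S hS => ?_
  rw [prod_mul_distrib, prod_const, (mem_powersetCard.1 hS).2]
  ring

lemma genPartial_congr {e : Fin n} {z z' : Fin n → R} (h : ∀ i ≠ e, z i = z' i) :
    genPartial ℓ ν e z = genPartial ℓ ν e z' := by
  unfold genPartial
  refine sum_congr rfl fun S _ => ?_
  rw [prod_congr rfl fun i hi => h i (mem_erase.1 hi).1]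

lemma genEval_eq_add (e : Fin n) (z : Fin n → R) :
    genEval ℓ ν z = genEval ℓ ν (Function.update z e 0) + z e * genPartial ℓ ν e z := by
  unfold genEval genPartial
  rw [mul_sum, sum_filter, ← sum_add_distrib]
  refine sum_congr rfl fun S _ => ?_
  by_cases he : e ∈ S
  · rw [if_pos he, prod_eq_zero (f := Function.update z e 0) he (by simp),
      ← mul_prod_erase S z he]
    ring
  · rw [if_neg he, add_zero]
    congr 1
    refine prod_congr rfl fun i hi => ?_
    rw [Function.update_of_ne]
    rintro rfl
    exact he hi

open Polynomial in
lemma eval_zero_derivative_genEval (y x : Fin n → ℝ) :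
    (derivative (genEval ℓ ν fun i => (C (y i) + C (x i) * X : ℝ[X]))).eval 0 =
      ∑ i, x i * genPartial ℓ ν i y := by
  unfold genEval genPartial
  simp only [derivative_sum, eval_finsetSum, mul_sum, sum_filter, algebraMap_eq,
    derivative_C_mul, derivative_prod_finset, eval_mul, eval_C]
  rw [sum_comm]
  refine sum_congr rfl fun S _ => ?_
  simp only [mul_ite, mul_zero]
  rw [← sum_filter, filter_univ_mem]
  refine sum_congr rfl fun i _ => ?_
  simp [eval_prod]
  ring

lemma continuous_genPartial (e : Fin n) :
    Continuous (genPartial ℓ ν e : (Fin n → ℝ) → ℝ) := by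
  unfold genPartial
  fun_prop

end GeneratingPolynomial

section StableExchange

open Polynomial ComplexConjugate

/-- The Wronskian of a pair of real polynomials whose pencil is stable is nonnegative. -/
lemma wronskian_nonneg_of_stable {P Q : ℝ[X]}
    (h : ∀ w z : ℂ, 0 < w.im → 0 < z.im → aeval w P + z * aeval w Q ≠ 0) (s : ℝ) :
    0 ≤ (derivative P).eval s * Q.eval s - P.eval s * (derivative Q).eval s := by
  have hnonneg : ∀ w : ℂ, 0 < w.im → 0 ≤ (aeval w P * conj (aeval w Q)).im := by
    intro w hw
    by_contra! hlt
    have hQ : aeval w Q ≠ 0 := by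
      intro h0
      simp [h0] at hlt
    refine h w (-(aeval w P) / aeval w Q) hw ?_ (by field_simp; ring)
    have hsq := Complex.normSq_pos.2 hQ
    rw [Complex.div_im]
    simp only [Complex.mul_im, Complex.conj_im, Complex.conj_re] at hlt
    simp only [Complex.neg_im, Complex.neg_re]
    rw [← sub_div]
    apply div_pos _ hsq
    linarith
  have hline : HasDerivAt (fun t : ℝ => (s : ℂ) + t * Complex.I) Complex.I 0 := by
    have := ((Complex.ofRealCLM.hasDerivAt (x := (0 : ℝ))).mul_const Complex.I).const_add (s : ℂ)
    simpa using this
  have hd : ∀ P : ℝ[X], HasDerivAt (fun t : ℝ => aeval ((s : ℂ) + t * Complex.I) P)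
      (((derivative P).eval s : ℝ) * Complex.I) 0 := by
    intro P
    have h1 := P.hasDerivAt_aeval ((s : ℂ) + (0 : ℝ) * Complex.I)
    have h2 := h1.comp (0 : ℝ) hline
    have h3 : aeval ((s : ℂ) + (0 : ℝ) * Complex.I) (derivative P) =
        (((derivative P).eval s : ℝ) : ℂ) := by
      simpa using (aeval_algebraMap_apply_eq_algebraMap_eval (A := ℂ) s (derivative P))
    rw [h3] at h2
    exact h2
  have hconj : HasDerivAt (fun t : ℝ => conj (aeval ((s : ℂ) + t * Complex.I) Q))
      (conj ((((derivative Q).eval s : ℝ) : ℂ) * Complex.I)) 0 :=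
    (hd Q).star
  have hprod := (hd P).mul hconj
  have him := Complex.imCLM.hasFDerivAt.comp_hasDerivAt (0 : ℝ) hprod
  have he : ∀ P : ℝ[X], aeval ((s : ℂ) + (0 : ℝ) * Complex.I) P = ((P.eval s : ℝ) : ℂ) := by
    intro P
    simpa using (aeval_algebraMap_apply_eq_algebraMap_eval (A := ℂ) s P)
  have hslope := him.tendsto_slope_zero_right
  rw [he, he] at hslope
  have hval : Complex.imCLM ((((derivative P).eval s : ℝ) * Complex.I) * conj ((Q.eval s : ℝ) : ℂ) +
      ((P.eval s : ℝ) : ℂ) * conj ((((derivative Q).eval s : ℝ) : ℂ) * Complex.I)) =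
      (derivative P).eval s * Q.eval s - P.eval s * (derivative Q).eval s := by
    simp
    ring
  rw [hval] at hslope
  refine ge_of_tendsto hslope ?_
  filter_upwards [self_mem_nhdsWithin] with t ht
  have ht' : (0 : ℝ) < t := ht
  simp only [smul_eq_mul, zero_add, Function.comp_apply, Pi.mul_apply, Complex.imCLM_apply]
  rw [he, he]
  have h0 : (((P.eval s : ℝ) : ℂ) * conj ((Q.eval s : ℝ) : ℂ)).im = 0 := by simp
  rw [h0, sub_zero]
  exact mul_nonneg (inv_nonneg.2 ht'.le) (hnonneg _ (by simpa using ht'))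

/-- The quotient of a pair of real polynomials whose pencil is stable is monotone. -/
lemma div_monotoneOn_of_stable {P Q : ℝ[X]}
    (h : ∀ w z : ℂ, 0 < w.im → 0 < z.im → aeval w P + z * aeval w Q ≠ 0)
    (hQ : ∀ s : ℝ, 0 ≤ s → 0 < Q.eval s) :
    MonotoneOn (fun s => P.eval s / Q.eval s) (Set.Ici 0) := by
  have hder : ∀ s : ℝ, 0 ≤ s → HasDerivAt (fun s => P.eval s / Q.eval s)
      (((derivative P).eval s * Q.eval s - P.eval s * (derivative Q).eval s) / Q.eval s ^ 2) s :=
    fun s hs => (P.hasDerivAt s).div (Q.hasDerivAt s) (hQ s hs).ne'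
  refine monotoneOn_of_deriv_nonneg (convex_Ici 0)
    (fun s hs => (hder s hs).continuousAt.continuousWithinAt)
    (fun s hs => (hder s (interior_subset hs)).differentiableAt.differentiableWithinAt) ?_
  intro s hs
  rw [(hder s (interior_subset hs)).deriv]
  exact div_nonneg (wronskian_nonneg_of_stable h s) (sq_nonneg _)

/-- A real polynomial positive at `0` with only real nonpositive roots is nondecreasing at `0`. -/
lemma eval_zero_derivative_nonneg {q : ℝ[X]} (h0 : 0 < q.eval 0)
    (hroots : ∀ w : ℂ, aeval w q = 0 → w.im = 0 ∧ w.re ≤ 0) :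
    0 ≤ (derivative q).eval 0 := by
  have hmap : ∀ p : ℝ[X], (p.map (algebraMap ℝ ℂ)).eval 0 = ((p.eval 0 : ℝ) : ℂ) := by
    intro p
    have := eval_map_algebraMap p (0 : ℂ)
    rw [this]
    simpa using (aeval_algebraMap_apply_eq_algebraMap_eval (A := ℂ) 0 p)
  have hne : (q.map (algebraMap ℝ ℂ)).eval 0 ≠ 0 := by
    rw [hmap]
    exact_mod_cast h0.ne'
  have hsum := (IsAlgClosed.splits
    (q.map (algebraMap ℝ ℂ))).eval_derivative_div_eval_of_ne_zero hne
  rw [derivative_map, hmap, hmap] at hsum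
  have hre : ((derivative q).eval 0 / q.eval 0 : ℝ) =
      (((q.map (algebraMap ℝ ℂ)).roots.map fun z => 1 / (0 - z)).sum).re := by
    rw [← hsum, ← Complex.ofReal_div, Complex.ofReal_re]
  have hnn : 0 ≤ (((q.map (algebraMap ℝ ℂ)).roots.map fun z => 1 / (0 - z)).sum).re := by
    change 0 ≤ Complex.reAddGroupHom _
    rw [map_multiset_sum, Multiset.map_map]
    refine Multiset.sum_nonneg fun r hr => ?_
    obtain ⟨z, hz, rfl⟩ := Multiset.mem_map.1 hr
    have hz' : aeval z q = 0 := by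
      rw [← eval_map_algebraMap]
      exact isRoot_of_mem_roots hz
    obtain ⟨-, hzre⟩ := hroots z hz'
    simp only [Function.comp_apply, Complex.coe_reAddGroupHom, one_div, zero_sub, Complex.inv_re,
      Complex.neg_re]
    exact div_nonneg (by linarith) (Complex.normSq_nonneg _)
  rw [← hre] at hnn
  by_contra! hlt
  exact absurd hnn (not_le.2 (div_neg_of_neg_of_pos hlt h0))

variable {n ℓ : ℕ} {ν : Finset (Fin n) → ℝ}

lemma StronglyRayleigh.genEval_ne_zero (hν : StronglyRayleigh n ℓ ν) {z : Fin n → ℂ}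
    (hz : ∀ i, 0 < (z i).im) : genEval ℓ ν z ≠ 0 :=
  hν.2 z hz

lemma genPartial_le_genPartial (hν : StronglyRayleigh n ℓ ν) {e : Fin n} {v w : Fin n → ℝ}
    (hv : ∀ i ≠ e, 0 ≤ v i) (hvw : ∀ i ≠ e, v i ≤ w i) :
    genPartial ℓ ν e v ≤ genPartial ℓ ν e w := by
  unfold genPartial
  refine sum_le_sum fun S hS => mul_le_mul_of_nonneg_left ?_
    (hν.1 S (mem_powersetCard.1 (mem_filter.1 hS).1).2)
  exact prod_le_prod (fun i hi => hv i (mem_erase.1 hi).1) fun i hi => hvw i (mem_erase.1 hi).1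

/-- A boundary point of the hyperbolicity cone enters its interior along positive directions. -/
lemma genEval_add_smul_pos (hν : StronglyRayleigh n ℓ ν) {e : Fin n} {x y : Fin n → ℝ}
    (hxe : x e = -1) (hx : ∀ i ≠ e, 0 ≤ x i) (hy : ∀ i, 0 < y i)
    (hpos : 0 < genPartial ℓ ν e x)
    (hle : genPartial ℓ ν e x ≤ genEval ℓ ν (Function.update x e 0)) {s : ℝ} (hs : 0 < s) :
    0 < genEval ℓ ν (fun i => x i + y i * s) := by
  set L : Fin n → ℝ[X] := fun i => C (x i) + C (y i) * X with hL
  set P : ℝ[X] := genEval ℓ ν (Function.update L e 0) with hP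
  set Q : ℝ[X] := genPartial ℓ ν e L with hQ
  have hQeval : ∀ t : ℝ, Q.eval t = genPartial ℓ ν e (fun i => x i + y i * t) := by
    intro t
    have := map_genPartial (ℓ := ℓ) (ν := ν) (aeval (R := ℝ) t) e L
    simpa [hL] using this
  have hPeval : ∀ t : ℝ, P.eval t =
      genEval ℓ ν (Function.update (fun i => x i + y i * t) e 0) := by
    intro t
    have := map_genEval (ℓ := ℓ) (ν := ν) (aeval (R := ℝ) t) (Function.update L e 0)
    rw [coe_aeval_eq_eval] at this
    rw [hP, this]
    congr 1
    ext i
    by_cases hi : i = e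
    · subst hi; simp
    · simp [hi, hL]
  have hstable : ∀ w z : ℂ, 0 < w.im → 0 < z.im → aeval w P + z * aeval w Q ≠ 0 := by
    intro w z hw hz
    set v : Fin n → ℂ := Function.update (fun i => (x i : ℂ) + y i * w) e z with hv
    have h1 : aeval w P = genEval ℓ ν (Function.update v e 0) := by
      rw [hP, map_genEval]
      congr 1
      ext i
      by_cases hi : i = e
      · subst hi; simp
      · simp [hi, hL, hv]
    have h2 : aeval w Q = genPartial ℓ ν e v := by
      rw [hQ, map_genPartial]
      refine genPartial_congr fun i hi => ?_
      simp [hi, hL, hv]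
    have h3 : z = v e := by simp [hv]
    rw [h1, h2, h3, ← genEval_eq_add]
    refine hν.genEval_ne_zero fun i => ?_
    by_cases hi : i = e
    · subst hi; simpa [hv] using hz
    · simpa [hi, hv] using mul_pos (hy i) hw
  have hQpos : ∀ t : ℝ, 0 ≤ t → 0 < Q.eval t := by
    intro t ht
    rw [hQeval]
    refine hpos.trans_le (genPartial_le_genPartial hν hx fun i _ => ?_)
    exact le_add_of_nonneg_right (mul_nonneg (hy i).le ht)
  have hmono := div_monotoneOn_of_stable hstable hQpos (Set.mem_Ici.2 le_rfl)
    (Set.mem_Ici.2 hs.le) hs.le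
  have h0 : 1 ≤ P.eval 0 / Q.eval 0 := by
    rw [one_le_div (hQpos 0 le_rfl), hQeval, hPeval]
    simpa using hle
  have h1 := (one_le_div (hQpos s hs.le)).1 (h0.trans hmono)
  rw [genEval_eq_add e, hxe, ← hPeval, ← hQeval]
  nlinarith [mul_pos (mul_pos (hy e) hs) (hQpos s hs.le)]

/-- The derivative of the generating polynomial at a positive point is nonnegative in the
direction of a boundary point of the hyperbolicity cone. -/
lemma sum_mul_genPartial_nonneg_of_pos (hν : StronglyRayleigh n ℓ ν)
    (hfull : ∀ S : Finset (Fin n), S.card = ℓ → 0 < ν S) (hℓ : ℓ ≤ n)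
    {e : Fin n} {x y : Fin n → ℝ}
    (hxe : x e = -1) (hx : ∀ i ≠ e, 0 ≤ x i) (hy : ∀ i, 0 < y i)
    (hpos : 0 < genPartial ℓ ν e x)
    (hle : genPartial ℓ ν e x ≤ genEval ℓ ν (Function.update x e 0)) :
    0 ≤ ∑ i, x i * genPartial ℓ ν i y := by
  rw [← eval_zero_derivative_genEval]
  set q : ℝ[X] := genEval ℓ ν fun i => (C (y i) + C (x i) * X : ℝ[X]) with hq
  have hqeval : ∀ t : ℝ, q.eval t = genEval ℓ ν (fun i => y i + x i * t) := by
    intro t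
    have := map_genEval (ℓ := ℓ) (ν := ν) (aeval (R := ℝ) t) fun i => (C (y i) + C (x i) * X)
    simpa using this
  have hqaeval : ∀ t : ℂ, aeval t q = genEval ℓ ν (fun i => (y i : ℂ) + x i * t) := by
    intro t
    rw [hq, map_genEval]
    simp
  have hlower : ∀ t : ℂ, t.im < 0 → aeval t q ≠ 0 := by
    intro t ht
    have ht0 : t ≠ 0 := by rintro rfl; simp at ht
    have hline : (fun i => (y i : ℂ) + x i * t) = fun i => t * ((x i : ℂ) + y i * t⁻¹) := by
      ext i
      field_simp
      ring
    rw [hqaeval, hline, genEval_smul]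
    refine mul_ne_zero (pow_ne_zero _ ht0) (hν.genEval_ne_zero fun i => ?_)
    have : 0 < (t⁻¹).im := by
      rw [Complex.inv_im]
      exact div_pos (by linarith) (Complex.normSq_pos.2 ht0)
    simpa using mul_pos (hy i) this
  refine eval_zero_derivative_nonneg ?_ fun w hw => ?_
  · rw [hqeval]
    simp only [mul_zero, add_zero]
    unfold genEval
    refine sum_pos (fun S hS => ?_) ?_
    · exact mul_pos (hfull S (mem_powersetCard.1 hS).2) (prod_pos fun i _ => hy i)
    · rw [powersetCard_nonempty]
      simpa using hℓ
  · have him : w.im = 0 := by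
      rcases lt_trichotomy w.im 0 with h | h | h
      · exact absurd hw (hlower w h)
      · exact h
      · refine absurd ?_ (hlower (conj w) (by simpa using h))
        have := congrArg conj hw
        rw [map_zero] at this
        rw [← this]
        exact aeval_algHom_apply Complex.conjAe.toAlgHom w q
    refine ⟨him, ?_⟩
    by_contra! hre
    have hwr : w = (w.re : ℂ) := Complex.ext rfl (by simpa using him)
    have hq0 : q.eval w.re = 0 := by
      rw [hwr] at hw
      have h := aeval_algebraMap_apply_eq_algebraMap_eval (A := ℂ) w.re q
      rw [Complex.coe_algebraMap, hw] at h
      exact_mod_cast h.symm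
    have hline : (fun i => y i + x i * w.re) = fun i => w.re * (x i + y i * w.re⁻¹) := by
      ext i
      field_simp
      ring
    rw [hqeval, hline, genEval_smul] at hq0
    exact (mul_pos (pow_pos hre ℓ)
      (genEval_add_smul_pos hν hxe hx hy hpos hle (inv_pos.2 hre))).ne' hq0

lemma sum_mul_genPartial_nonneg (hν : StronglyRayleigh n ℓ ν)
    (hfull : ∀ S : Finset (Fin n), S.card = ℓ → 0 < ν S) (hℓ : ℓ ≤ n)
    {e : Fin n} {x y : Fin n → ℝ}
    (hxe : x e = -1) (hx : ∀ i ≠ e, 0 ≤ x i) (hy : ∀ i, 0 ≤ y i)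
    (hpos : 0 < genPartial ℓ ν e x)
    (hle : genPartial ℓ ν e x ≤ genEval ℓ ν (Function.update x e 0)) :
    0 ≤ ∑ i, x i * genPartial ℓ ν i y := by
  have hcont : Continuous fun t : ℝ => ∑ i, x i * genPartial ℓ ν i (fun j => y j + t) := by
    refine continuous_finsetSum _ fun i _ => continuous_const.mul ?_
    exact (continuous_genPartial i).comp (by fun_prop)
  have hlim := (hcont.tendsto 0).mono_left (nhdsWithin_le_nhds (s := Set.Ioi 0))
  simp only [add_zero] at hlim
  refine ge_of_tendsto hlim ?_
  filter_upwards [self_mem_nhdsWithin] with t ht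
  exact sum_mul_genPartial_nonneg_of_pos hν hfull hℓ hxe hx
    (fun i => add_pos_of_nonneg_of_pos (hy i) ht) hpos hle

/-- The direction with entry `-1` at `e` and `c` on `U`. -/
def exchangeDirection (c : ℝ) (U : Finset (Fin n)) (e : Fin n) (i : Fin n) : ℝ :=
  if i = e then -1 else if i ∈ U then c else 0

lemma genEval_update_exchangeDirection {c : ℝ} {U : Finset (Fin n)} {e : Fin n}
    (hU : U.card = ℓ) (he : e ∉ U) :
    genEval ℓ ν (Function.update (exchangeDirection c U e) e 0) = ν U * c ^ ℓ := by
  unfold genEval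
  rw [sum_eq_single_of_mem U (by simp [mem_powersetCard, hU])]
  · congr 1
    rw [← hU, ← prod_const]
    refine prod_congr rfl fun i hi => ?_
    have hie : i ≠ e := by rintro rfl; exact he hi
    simp [exchangeDirection, hie, hi]
  · intro S hS hSU
    have hSc := (mem_powersetCard.1 hS).2
    have hnot : ¬ S ⊆ U := fun h => hSU (eq_of_subset_of_card_le h (by omega))
    obtain ⟨i, hiS, hiU⟩ := not_subset.1 hnot
    rw [prod_eq_zero hiS, mul_zero]
    by_cases hie : i = e
    · subst hie; simp
    · simp [exchangeDirection, hie, hiU]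

lemma genPartial_exchangeDirection {c : ℝ} {U : Finset (Fin n)} {e : Fin n}
    (hU : U.card = ℓ) (he : e ∉ U) :
    genPartial ℓ ν e (exchangeDirection c U e) =
      ∑ f ∈ U, ν (insert e (U.erase f)) * c ^ (ℓ - 1) := by
  have hinj : Set.InjOn (fun f => insert e (U.erase f)) (U : Set (Fin n)) := by
    intro f hf g hg hfg
    have hfe : f ≠ e := by rintro rfl; exact he hf
    by_contra hne
    have : f ∈ insert e (U.erase g) := by simp [hne, mem_coe.1 hf]
    rw [← (show insert e (U.erase f) = insert e (U.erase g) from hfg)] at this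
    simp [hfe] at this
  have herase : ∀ f, (insert e (U.erase f)).erase e = U.erase f := fun f =>
    erase_insert fun h => he (mem_of_mem_erase h)
  have hcard : ∀ f ∈ U, (insert e (U.erase f)).card = ℓ := by
    intro f hf
    rw [card_insert_of_notMem fun h => he (mem_of_mem_erase h), card_erase_add_one hf, hU]
  unfold genPartial
  symm
  rw [← sum_image (f := fun S => ν S * c ^ (ℓ - 1)) hinj]
  symm
  refine (sum_subset_zero_on_sdiff ?_ ?_ ?_).symm
  · intro S hS
    obtain ⟨f, hf, rfl⟩ := mem_image.1 hS
    simp [mem_powersetCard, hcard f hf]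
  · intro S hS
    obtain ⟨hS1, hS2⟩ := mem_sdiff.1 hS
    obtain ⟨hSc, heS⟩ := mem_filter.1 hS1
    replace hSc := (mem_powersetCard.1 hSc).2
    have hnot : ¬ S.erase e ⊆ U := by
      intro hsub
      have hc1 : (S.erase e).card + 1 = U.card := by rw [card_erase_add_one heS, hSc, hU]
      obtain ⟨f, hf⟩ := card_eq_one.1
        (show (U \ S.erase e).card = 1 by rw [card_sdiff_of_subset hsub]; omega)
      refine hS2 (mem_image.2 ⟨f, ?_, ?_⟩)
      · exact (mem_sdiff.1 (hf ▸ mem_singleton_self f)).1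
      · rw [← sdiff_singleton_eq_erase, ← hf, Finset.sdiff_sdiff_eq_self hsub, insert_erase heS]
    obtain ⟨i, hiS, hiU⟩ := not_subset.1 hnot
    rw [prod_eq_zero hiS, mul_zero]
    simp [exchangeDirection, (mem_erase.1 hiS).1, hiU]
  · intro S hS
    obtain ⟨f, hf, rfl⟩ := mem_image.1 hS
    rw [herase]
    have : ∏ i ∈ U.erase f, exchangeDirection c U e i = c ^ (ℓ - 1) := by
      rw [← hU, ← card_erase_of_mem hf, ← prod_const]
      refine prod_congr rfl fun i hi => ?_
      have hiU := mem_of_mem_erase hi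
      have hie : i ≠ e := by rintro rfl; exact he hiU
      simp [exchangeDirection, hie, hiU]
    rw [this]
    rfl

/-- If all single exchanges bringing `e` into `U` gain at most a factor `ζ`, then
the `e`-derivative of the generating polynomial at a nonnegative point is at most
`ζℓ` times the sum of its derivatives along `U`. -/
lemma genPartial_le_mul_sum (hν : StronglyRayleigh n ℓ ν)
    (hfull : ∀ S : Finset (Fin n), S.card = ℓ → 0 < ν S) (hℓ : 1 ≤ ℓ)
    {ζ : ℝ} (hζ : 1 ≤ ζ) {U : Finset (Fin n)} {e : Fin n} (hU : U.card = ℓ) (he : e ∉ U)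
    (hopt : ∀ f ∈ U, ν (insert e (U.erase f)) ≤ ζ * ν U)
    {y : Fin n → ℝ} (hy : ∀ i, 0 ≤ y i) :
    genPartial ℓ ν e y ≤ ζ * ℓ * ∑ f ∈ U, genPartial ℓ ν f y := by
  have hc : 0 < ζ * ℓ := mul_pos (by linarith) (by exact_mod_cast hℓ)
  have hne : U.Nonempty := card_pos.1 (by omega)
  have key := sum_mul_genPartial_nonneg (x := exchangeDirection (ζ * ℓ) U e) (y := y) (e := e)
    hν hfull (hU ▸ card_finset_fin_le U) (by simp [exchangeDirection]) ?_ hy ?_ ?_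
  · have hsum : ∑ i, exchangeDirection (ζ * ℓ) U e i * genPartial ℓ ν i y =
        -genPartial ℓ ν e y + ζ * ℓ * ∑ f ∈ U, genPartial ℓ ν f y := by
      have hterm : ∀ i, exchangeDirection (ζ * ℓ) U e i * genPartial ℓ ν i y =
          (if i = e then -genPartial ℓ ν e y else 0) +
            (if i ∈ U then ζ * ℓ * genPartial ℓ ν i y else 0) := by
        intro i
        by_cases hie : i = e
        · subst hie; simp [exchangeDirection, he]
        · simp [exchangeDirection, hie]
      rw [sum_congr rfl fun i _ => hterm i, sum_add_distrib, ← sum_filter, ← sum_filter,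
        filter_univ_mem, mul_sum]
      simp [filter_eq']
    linarith
  · intro i hi
    simp only [exchangeDirection, hi, if_false]
    split_ifs
    exacts [hc.le, le_rfl]
  · rw [genPartial_exchangeDirection hU he]
    refine sum_pos (fun f hf => mul_pos (hfull _ ?_) (pow_pos hc _)) hne
    rw [card_insert_of_notMem fun h => he (mem_of_mem_erase h), card_erase_add_one hf, hU]
  · rw [genPartial_exchangeDirection hU he, genEval_update_exchangeDirection hU he]
    calc ∑ f ∈ U, ν (insert e (U.erase f)) * (ζ * ℓ) ^ (ℓ - 1)
        ≤ ∑ f ∈ U, ζ * ν U * (ζ * ℓ) ^ (ℓ - 1) := by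
          gcongr with f hf
          exact hopt f hf
      _ = ν U * (ζ * ℓ) ^ ℓ := by
          rw [sum_const, hU, nsmul_eq_mul, ← Nat.sub_add_cancel hℓ, pow_succ]
          simp
          ring

/-- The weight of the points of `S`, equal to `w` on `U` and to `1` elsewhere. -/
def restrictedWeight (w : ℝ) (U S : Finset (Fin n)) (i : Fin n) : ℝ :=
  if i ∈ S then if i ∈ U then w else 1 else 0

lemma prod_restrictedWeight (w : ℝ) (U S T : Finset (Fin n)) :
    ∏ i ∈ T, restrictedWeight w U S i = if T ⊆ S then w ^ (T ∩ U).card else 0 := by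
  split_ifs with h
  · unfold restrictedWeight
    rw [prod_congr rfl fun i hi => if_pos (h hi), ← prod_filter, prod_const, filter_mem_eq_inter]
  · obtain ⟨i, hiT, hiS⟩ := not_subset.1 h
    exact prod_eq_zero hiT (if_neg hiS)

lemma genPartial_restrictedWeight_self {w : ℝ} {U S : Finset (Fin n)} {e : Fin n}
    (heS : e ∈ S) (heU : e ∉ U) :
    genPartial ℓ ν e (restrictedWeight w U (S.erase e)) =
      ∑ W ∈ powersetCard ℓ S with e ∈ W, w ^ (W ∩ U).card * ν W := by
  unfold genPartial
  simp only [prod_restrictedWeight, mul_ite, mul_zero]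
  rw [← sum_filter, filter_filter]
  refine sum_congr ?_ fun W _ => ?_
  · ext W
    simp only [mem_filter, mem_powersetCard, subset_univ, true_and]
    constructor
    · rintro ⟨hc, heW, hsub⟩
      refine ⟨⟨?_, hc⟩, heW⟩
      rw [← insert_erase heW, ← insert_erase heS]
      exact insert_subset_insert e hsub
    · rintro ⟨⟨hsub, hc⟩, heW⟩
      exact ⟨hc, heW, erase_subset_erase e hsub⟩
  · rw [erase_inter, erase_eq_of_notMem fun h => heU (mem_inter.1 h).2]
    exact mul_comm _ _

lemma mul_genPartial_restrictedWeight {w : ℝ} {U S : Finset (Fin n)} {e f : Fin n}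
    (heS : e ∈ S) (heU : e ∉ U) (hfU : f ∈ U) :
    w * genPartial ℓ ν f (restrictedWeight w U (S.erase e)) =
      ∑ W ∈ powersetCard ℓ S with e ∈ W ∧ f ∉ W,
        w ^ (insert f (W.erase e) ∩ U).card * ν (insert f (W.erase e)) := by
  have hef : e ≠ f := by rintro rfl; exact heU hfU
  unfold genPartial
  simp only [prod_restrictedWeight, mul_ite, mul_zero]
  rw [← sum_filter, filter_filter, mul_sum]
  refine sum_bij' (fun W _ => insert e (W.erase f)) (fun W _ => insert f (W.erase e))
    ?_ ?_ ?_ ?_ ?_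
  · intro W hW
    simp only [mem_filter, mem_powersetCard, subset_univ, true_and] at hW
    obtain ⟨hc, hfW, hsub⟩ := hW
    have heW : e ∉ W.erase f := fun h => (mem_erase.1 (hsub h)).1 rfl
    simp only [mem_filter, mem_powersetCard]
    refine ⟨⟨insert_subset heS (hsub.trans (erase_subset e S)), ?_⟩, mem_insert_self _ _, ?_⟩
    · rw [card_insert_of_notMem heW, card_erase_add_one hfW, hc]
    · simp [hef.symm]
  · intro W hW
    simp only [mem_filter, mem_powersetCard] at hW
    obtain ⟨⟨hsub, hc⟩, heW, hfW⟩ := hW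
    have hfW' : f ∉ W.erase e := fun h => hfW (mem_of_mem_erase h)
    simp only [mem_filter, mem_powersetCard, subset_univ, true_and]
    refine ⟨?_, mem_insert_self _ _, ?_⟩
    · rw [card_insert_of_notMem hfW', card_erase_add_one heW, hc]
    · rw [erase_insert hfW']
      exact erase_subset_erase e hsub
  · intro W hW
    simp only [mem_filter, mem_powersetCard, subset_univ, true_and] at hW
    obtain ⟨hc, hfW, hsub⟩ := hW
    have heW : e ∉ W.erase f := fun h => (mem_erase.1 (hsub h)).1 rfl
    simp only [erase_insert heW, insert_erase hfW]
  · intro W hW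
    simp only [mem_filter, mem_powersetCard] at hW
    obtain ⟨-, heW, hfW⟩ := hW
    have hfW' : f ∉ W.erase e := fun h => hfW (mem_of_mem_erase h)
    simp only [erase_insert hfW', insert_erase heW]
  · intro W hW
    simp only [mem_filter, mem_powersetCard, subset_univ, true_and] at hW
    obtain ⟨hc, hfW, hsub⟩ := hW
    have heW : e ∉ W.erase f := fun h => (mem_erase.1 (hsub h)).1 rfl
    rw [erase_insert heW, insert_erase hfW, erase_inter,
      ← card_erase_add_one (mem_inter.2 ⟨hfW, hfU⟩), pow_succ]
    simp only [Algebra.algebraMap_self, RingHom.id_apply]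
    ring

end StableExchange

/-- the "smart exchange" lemma, with weight `φ(W) = (ζℓ)^{2|W∩U|}`:
an element `e ∈ (V∩S)∖U` can be exchanged for some `f ∈ U` without decreasing the
`φ`-weighted sum of `ν` over `ℓ`-subsets of `S`. -/
theorem stmt3 (n ℓ k : ℕ) (hℓ1 : 1 ≤ ℓ) (hℓk : ℓ ≤ k) (hkn : k ≤ n)
    (ν : Finset (Fin n) → ℝ) (hν : StronglyRayleigh n ℓ ν)
    (hfull : ∀ S : Finset (Fin n), S.card = ℓ → 0 < ν S)
    (ζ : ℝ) (hζ : 1 ≤ ζ)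
    (V U : Finset (Fin n)) (hU : ApproxLocalOpt n ℓ ζ ν V U)
    (S : Finset (Fin n)) (hS : S.card = k)
    (e : Fin n) (he : e ∈ (V ∩ S) \ U) :
    ∃ f ∈ U,
      (∑ W ∈ Finset.powersetCard ℓ S,
          (ζ * ℓ) ^ (2 * (W ∩ U).card) * ν W) ≤
      (∑ W ∈ (Finset.powersetCard ℓ S).filter (fun W => e ∉ W),
          (ζ * ℓ) ^ (2 * (W ∩ U).card) * ν W) +
      (∑ W ∈ (Finset.powersetCard ℓ S).filter (fun W => e ∈ W ∧ f ∉ W),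
          (ζ * ℓ) ^ (2 * ((insert f (W.erase e)) ∩ U).card) *
            ν (insert f (W.erase e))) := by
  obtain ⟨-, hUcard, hopt⟩ := hU
  obtain ⟨heVS, heU⟩ := mem_sdiff.1 he
  obtain ⟨heV, heS⟩ := mem_inter.1 heVS
  have hc : 1 ≤ ζ * ℓ := one_le_mul_of_one_le_of_one_le hζ (by exact_mod_cast hℓ1)
  set y := restrictedWeight ((ζ * ℓ) ^ 2) U (S.erase e) with hy
  have hy0 : ∀ i, 0 ≤ y i := by
    intro i
    simp only [hy, restrictedWeight]
    split_ifs <;> positivity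
  have hne : U.Nonempty := card_pos.1 (by omega)
  obtain ⟨f, hfU, hmax⟩ := exists_max_image U (fun f => genPartial ℓ ν f y) hne
  have hfnonneg : 0 ≤ genPartial ℓ ν f y := by
    unfold genPartial
    exact sum_nonneg fun W hW => mul_nonneg
      (hν.1 W (mem_powersetCard.1 (mem_filter.1 hW).1).2) (prod_nonneg fun i _ => hy0 i)
  have key : genPartial ℓ ν e y ≤ (ζ * ℓ) ^ 2 * genPartial ℓ ν f y := by
    calc genPartial ℓ ν e y ≤ ζ * ℓ * ∑ g ∈ U, genPartial ℓ ν g y :=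
          genPartial_le_mul_sum hν hfull hℓ1 hζ hUcard heU
            (fun g hg => hopt g hg e (mem_sdiff.2 ⟨heV, heU⟩)) hy0
      _ ≤ ζ * ℓ * (ℓ * genPartial ℓ ν f y) := by
          gcongr
          simpa [hUcard] using sum_le_card_nsmul U _ _ hmax
      _ ≤ ζ * ℓ * (ζ * ℓ * genPartial ℓ ν f y) := by
          gcongr
          exact le_mul_of_one_le_left (by positivity) hζ
      _ = (ζ * ℓ) ^ 2 * genPartial ℓ ν f y := by ring
  refine ⟨f, hfU, ?_⟩
  rw [hy, genPartial_restrictedWeight_self heS heU,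
    mul_genPartial_restrictedWeight heS heU hfU] at key
  simp only [pow_mul]
  rw [← sum_filter_add_sum_filter_not (powersetCard ℓ S) (fun W => e ∈ W), add_comm]
  gcongr
end

section
/- Let ν be a strongly Rayleigh function on the ℓ-element subsets of {1,…,n} with full support, let ζ ≥ 1, let k ≥ ℓ, let V ⊆ {1,…,n}, let k_V ≥ 1, and let U = U_1∪…∪U_{k_V} be a (V,k_V,ζ)-peeling coreset with respect to ν. Define μ̃(S) = Σ_{W⊆S, |W|=ℓ} (ζℓ)^{2|W∩U|}·ν(W). Then for every k-element set S ⊆ {1,…,n} with |S∩V| ≤ k_V and every e ∈ S∩V, there exists f ∈ U∖(S∖{e}) such that μ̃(S) ≤ μ̃((S∖{e})∪{f}) and |((S∖{e})∪{f})∩V| ≤ k_V. -/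
open Finset

/-- A `(V, kV, ζ)`-peeling coreset with respect to `ν`: `U = U_1 ∪ … ∪ U_{kV}` where
`U_i` is an `ℓ`-element `ζ`-approximate local optimum of `ν` inside
`V_i = V ∖ (U_1 ∪ … ∪ U_{i-1})`. -/
def PeelingCoreset (n ℓ : ℕ) (ζ : ℝ) (ν : Finset (Fin n) → ℝ)
    (V : Finset (Fin n)) (kV : ℕ) (U : Finset (Fin n)) : Prop :=
  ∃ Us : Fin kV → Finset (Fin n),
    (∀ i : Fin kV, ApproxLocalOpt n ℓ ζ ν
      (V \ ((Finset.univ.filter (fun j => j < i)).biUnion Us)) (Us i)) ∧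
    U = Finset.univ.biUnion Us

section QuadraticFactor
open Polynomial

/-- A monic real polynomial of positive even degree whose complex roots avoid the open right half
plane has a monic quadratic factor with nonnegative coefficients. -/
theorem exists_quadratic_dvd_of_roots_re_nonpos {p : ℝ[X]} (hp : p.Monic)
    (hpos : 0 < p.natDegree) (heven : Even p.natDegree)
    (hroot : ∀ x : ℂ, 0 < x.re → aeval x p ≠ 0) :
    ∃ u v : ℝ, 0 ≤ u ∧ 0 ≤ v ∧ X ^ 2 + C u * X + C v ∣ p := by
  by_cases hreal : ∀ z : ℂ, aeval z p = 0 → z.im = 0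
  · have real_root : ∀ g : ℝ[X], g ∣ p → g.natDegree ≠ 0 → ∃ r : ℝ, r ≤ 0 ∧ X - C r ∣ g := by
      intro g hg hdeg
      obtain ⟨z, hz⟩ := IsAlgClosed.exists_aeval_eq_zero ℂ g
        (fun h => hdeg (natDegree_eq_zero_iff_degree_le_zero.2 h.le))
      have hzp : aeval z p = 0 := aeval_eq_zero_of_dvd_aeval_eq_zero hg hz
      have hzr : z = ((z.re : ℝ) : ℂ) := Complex.ext rfl (by simpa using hreal z hzp)
      refine ⟨z.re, not_lt.1 fun h => hroot z h hzp, dvd_iff_isRoot.2 ?_⟩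
      rw [hzr] at hz
      have h2 : aeval ((algebraMap ℝ ℂ) z.re) g = 0 := hz
      rw [aeval_algebraMap_apply] at h2
      simpa using h2
    obtain ⟨r, hr, g, hg⟩ := real_root p dvd_rfl hpos.ne'
    have hgm : g.Monic := (monic_X_sub_C r).of_mul_monic_left (hg ▸ hp)
    have hd : p.natDegree = 1 + g.natDegree := by
      rw [hg, (monic_X_sub_C r).natDegree_mul hgm, natDegree_X_sub_C]
    obtain ⟨s, hs, h, hh⟩ := real_root g ⟨X - C r, by rw [hg, mul_comm]⟩
      (by rintro h0; rw [hd, h0] at heven; exact absurd heven (by decide))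
    refine ⟨-r - s, r * s, by linarith, mul_nonneg_of_nonpos_of_nonpos hr hs, h, ?_⟩
    rw [hg, hh]
    simp only [C_sub, C_neg, C_mul]
    ring
  · push Not at hreal
    obtain ⟨z, hz, him⟩ := hreal
    refine ⟨-(2 * z.re), ‖z‖ ^ 2, ?_, by positivity, ?_⟩
    · have := not_lt.1 fun h => hroot z h hz
      linarith
    · simpa [sub_eq_add_neg] using quadratic_dvd_of_aeval_eq_zero_im_ne_zero p hz him

/-- The outer coefficients of an even-degree monic real polynomial without complex roots in the
open right half plane satisfy `a₁ ≤ a₂ * a_{d-1}`, and all its coefficients are nonnegative. -/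
theorem coeff_nonneg_and_coeff_one_le_of_roots_re_nonpos {p : ℝ[X]} (hp : p.Monic)
    (heven : Even p.natDegree) (hroot : ∀ x : ℂ, 0 < x.re → aeval x p ≠ 0) :
    (∀ i, 0 ≤ p.coeff i) ∧ p.coeff 1 ≤ p.coeff 2 * p.nextCoeff := by
  induction hN : p.natDegree using Nat.strong_induction_on generalizing p with
  | _ N ih =>
  rcases Nat.eq_zero_or_pos p.natDegree with h0 | hpos
  · obtain rfl : p = 1 := hp.natDegree_eq_zero.1 h0
    refine ⟨fun i => ?_, by simp [coeff_one, nextCoeff]⟩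
    rw [coeff_one]
    split_ifs <;> norm_num
  obtain ⟨u, v, hu, hv, g, rfl⟩ := exists_quadratic_dvd_of_roots_re_nonpos hp hpos heven hroot
  have hdeg : (X ^ 2 + C u * X + C v : ℝ[X]).natDegree = 2 := by compute_degree!
  have hqm : (X ^ 2 + C u * X + C v : ℝ[X]).Monic := by monicity!
  have hnext : (X ^ 2 + C u * X + C v : ℝ[X]).nextCoeff = u := by
    rw [nextCoeff_of_natDegree_pos (by omega), hdeg]
    simp [coeff_X_pow, coeff_C]
  have hgm : g.Monic := hqm.of_mul_monic_left hp
  have hd := hqm.natDegree_mul hgm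
  rw [hdeg] at hd
  obtain ⟨hnn, hle⟩ := ih g.natDegree (by omega) hgm
    (by rw [hd] at heven; exact (Nat.even_add.1 heven).1 even_two)
    (fun x hx h => hroot x hx (by rw [map_mul, h, mul_zero])) rfl
  have hnc : 0 ≤ g.nextCoeff := by
    rw [nextCoeff]; split_ifs
    · exact le_rfl
    · exact hnn _
  constructor
  · intro i
    rw [coeff_mul]
    refine sum_nonneg fun x _ => mul_nonneg ?_ (hnn _)
    simp only [coeff_add, coeff_X_pow, coeff_C_mul, coeff_X, coeff_C]
    split_ifs <;> simp <;> positivity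
  · rw [hqm.nextCoeff_mul hgm, hnext]
    have e1 : ((X ^ 2 + C u * X + C v) * g).coeff 1 = v * g.coeff 1 + u * g.coeff 0 := by
      rw [mul_coeff_one]
      simp [coeff_X_pow, coeff_C]
    have e2 : ((X ^ 2 + C u * X + C v) * g).coeff 2 =
        v * g.coeff 2 + u * g.coeff 1 + g.coeff 0 := by
      rw [coeff_mul, Finset.Nat.antidiagonal_succ, sum_cons, sum_map,
        Finset.Nat.antidiagonal_succ, sum_cons, sum_map]
      simp [coeff_X_pow, coeff_C, coeff_X]
      ring
    rw [e1, e2]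
    have h0 := hnn 0
    have h1 := hnn 1
    have h2 := hnn 2
    nlinarith [mul_le_mul_of_nonneg_left hle hv, mul_nonneg (mul_nonneg hv h2) hu,
      mul_nonneg (mul_nonneg hu h1) hu, mul_nonneg (mul_nonneg hu h1) hnc, mul_nonneg h0 hnc]
end QuadraticFactor

section Exchange
open Polynomial

variable {n : ℕ}

/-- Degree in `x` of `∏ i ∈ W, z i` after substituting `z i = x ^ 2` for `i ∈ B`, `z e = x`, and
constants for the other variables. -/
def exchangeDegree (B : Finset (Fin n)) (e : Fin n) (W : Finset (Fin n)) : ℕ :=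
  2 * (W ∩ B).card + if e ∈ W then 1 else 0

theorem prod_pow_eq_pow_exchangeDegree {R : Type*} [CommMonoid R] {B : Finset (Fin n)} {e : Fin n}
    (he : e ∉ B) (W : Finset (Fin n)) (x : R) :
    ∏ i ∈ W, x ^ (if i ∈ B then 2 else if i = e then 1 else 0) = x ^ exchangeDegree B e W := by
  rw [prod_pow_eq_pow_sum, exchangeDegree]
  congr 1
  have h : ∀ i ∈ W, (if i ∈ B then 2 else if i = e then 1 else 0) =
      2 * (if i ∈ B then 1 else 0) + if i = e then 1 else 0 := by
    intro i _
    by_cases h1 : i ∈ B <;> by_cases h2 : i = e <;> simp_all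
  rw [sum_congr rfl h, sum_add_distrib, ← mul_sum]
  simp [sum_ite_mem]

theorem exchangeDegree_le {B W : Finset (Fin n)} {e : Fin n} (he : e ∉ B)
    (hW : W.card = B.card) : exchangeDegree B e W ≤ 2 * B.card := by
  rw [exchangeDegree]
  split_ifs with h
  · have : (W ∩ B).card < W.card :=
      card_lt_card (Finset.ssubset_iff_subset_ne.2 ⟨inter_subset_left, fun h' => he
        (mem_inter.1 (h'.symm ▸ h : e ∈ W ∩ B)).2⟩)
    omega
  · have : (W ∩ B).card ≤ W.card := card_le_card inter_subset_left
    omega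

theorem eq_of_exchangeDegree_eq_two_mul {B W : Finset (Fin n)} {e : Fin n}
    (hW : W.card = B.card) (h : exchangeDegree B e W = 2 * B.card) : W = B := by
  rw [exchangeDegree] at h
  have h1 : W.card ≤ (W ∩ B).card := by split_ifs at h <;> omega
  have h2 := eq_of_subset_of_card_le inter_subset_left h1
  exact eq_of_subset_of_card_le (inter_eq_left.1 h2) hW.ge

theorem exists_eq_insert_erase_of_exchangeDegree {B W : Finset (Fin n)} {e : Fin n}
    (hW : W.card = B.card) (h : exchangeDegree B e W = 2 * B.card - 1) (hB : 0 < B.card)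
    (he : e ∉ B) : ∃ g ∈ B, insert e (B.erase g) = W := by
  rw [exchangeDegree] at h
  have heW : e ∈ W := by
    by_contra h'
    rw [if_neg h'] at h
    omega
  rw [if_pos heW] at h
  obtain ⟨g, hg, hgW⟩ : ∃ g ∈ B, g ∉ W := by
    by_contra! h'
    have := inter_eq_right.2 (show B ⊆ W from h')
    rw [this] at h
    omega
  refine ⟨g, hg, ?_⟩
  have h1 : W ∩ B = B.erase g := by
    refine eq_of_subset_of_card_le (fun x hx => ?_) ?_
    · rw [mem_inter] at hx
      exact mem_erase.2 ⟨fun h' => hgW (h' ▸ hx.1), hx.2⟩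
    · rw [card_erase_of_mem hg]
      omega
  refine eq_of_subset_of_card_le (insert_subset heW (h1 ▸ inter_subset_left)) ?_
  rw [card_insert_of_notMem (fun h' => he (mem_of_mem_erase h')), card_erase_of_mem hg]
  omega

/-- The specialization of the generating polynomial of `ν / ν B` at `z i = x ^ 2` for `i ∈ B`,
`z e = x`, each variable being further scaled by `c i`. -/
noncomputable def exchangePolynomial (ν : Finset (Fin n) → ℝ) (B : Finset (Fin n)) (e : Fin n)
    (c : Fin n → ℝ) : ℝ[X] :=
  ∑ W ∈ powersetCard B.card univ,
    monomial (exchangeDegree B e W) (ν W / ν B * ∏ i ∈ W, c i)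

theorem coeff_exchangePolynomial (ν : Finset (Fin n) → ℝ) (B : Finset (Fin n)) (e : Fin n)
    (c : Fin n → ℝ) (j : ℕ) :
    (exchangePolynomial ν B e c).coeff j =
      (∑ W ∈ powersetCard B.card univ with exchangeDegree B e W = j, ν W * ∏ i ∈ W, c i) / ν B := by
  simp only [exchangePolynomial, finsetSum_coeff, coeff_monomial, sum_filter, sum_div]
  refine sum_congr rfl fun W _ => ?_
  split_ifs <;> ring

theorem aeval_exchangePolynomial_ne_zero {ν : Finset (Fin n) → ℝ} {B : Finset (Fin n)} {e : Fin n}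
    {c : Fin n → ℝ} (hν : StronglyRayleigh n B.card ν) (hB : 0 < ν B) (he : e ∉ B)
    (hc : ∀ i, 0 < c i) {x : ℂ} (hx : 0 < x.re) :
    aeval x (exchangePolynomial ν B e c) ≠ 0 := by
  intro h
  obtain ⟨w, hw⟩ : ∃ w : ℂ, w = Complex.I * (starRingEnd ℂ) x := ⟨_, rfl⟩
  refine hν.2 (fun i => w * (c i * x ^ (if i ∈ B then 2 else if i = e then 1 else 0)))
    (fun i => ?_) ?_
  · have hn : 0 < x.re * x.re + x.im * x.im := by nlinarith [mul_self_nonneg x.im]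
    have h0 : w.im = x.re := by simp [hw]
    have h1 : (w * x).im = x.re * x.re + x.im * x.im := by simp [hw, add_comm]
    have h2 : (w * x ^ 2).im = (x.re * x.re + x.im * x.im) * x.re := by
      simp [hw, pow_two]; ring
    have key : ∀ y : ℂ, 0 < (w * y).im → 0 < (w * (c i * y)).im := by
      intro y hy
      rw [mul_left_comm, Complex.im_ofReal_mul]
      exact mul_pos (hc i) hy
    apply key
    split_ifs
    · rw [h2]; positivity
    · rw [pow_one, h1]; exact hn
    · rw [pow_zero, mul_one, h0]; exact hx
  · have h3 : ∑ W ∈ powersetCard B.card (univ : Finset (Fin n)), (ν W : ℂ) *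
        ∏ i ∈ W, (w * (c i * x ^ (if i ∈ B then 2 else if i = e then 1 else 0))) =
        w ^ B.card * ν B * aeval x (exchangePolynomial ν B e c) := by
      rw [exchangePolynomial, map_sum, mul_sum]
      refine sum_congr rfl fun W hW => ?_
      rw [prod_mul_distrib, prod_mul_distrib, prod_pow_eq_pow_exchangeDegree he, prod_const,
        (mem_powersetCard.1 hW).2, aeval_monomial]
      have hB' : (ν B : ℂ) ≠ 0 := by exact_mod_cast hB.ne'
      simp only [Complex.coe_algebraMap, Complex.ofReal_mul, Complex.ofReal_div,
        Complex.ofReal_prod]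
      field_simp
    rw [h3, h, mul_zero]

theorem monic_exchangePolynomial {ν : Finset (Fin n) → ℝ} {B : Finset (Fin n)} {e : Fin n}
    {c : Fin n → ℝ} (hB : ν B ≠ 0) (he : e ∉ B) (hc : ∀ i ∈ insert e B, c i = 1) :
    (exchangePolynomial ν B e c).Monic ∧
      (exchangePolynomial ν B e c).natDegree = 2 * B.card := by
  have hle : (exchangePolynomial ν B e c).natDegree ≤ 2 * B.card :=
    natDegree_sum_le_of_forall_le _ _ fun W hW =>
      (natDegree_monomial_le _).trans (exchangeDegree_le he (mem_powersetCard.1 hW).2)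
  have hone : (exchangePolynomial ν B e c).coeff (2 * B.card) = 1 := by
    have : (powersetCard B.card (univ : Finset (Fin n))).filter
        (fun W => exchangeDegree B e W = 2 * B.card) = {B} := by
      ext W
      simp only [mem_filter, mem_powersetCard, subset_univ, true_and, mem_singleton]
      refine ⟨fun h => eq_of_exchangeDegree_eq_two_mul h.1 h.2, ?_⟩
      rintro rfl
      simp [exchangeDegree, he]
    rw [coeff_exchangePolynomial, this, sum_singleton,
      prod_congr rfl (fun i hi => hc i (mem_insert_of_mem hi)), prod_const_one, mul_one,
      div_self hB]
  exact ⟨monic_of_natDegree_le_of_coeff_eq_one _ hle hone,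
    natDegree_eq_of_le_of_coeff_ne_zero hle (by rw [hone]; exact one_ne_zero)⟩

theorem sum_exchangeDegree_one_le_of_pos {ν : Finset (Fin n) → ℝ} {B : Finset (Fin n)} {e : Fin n}
    {c : Fin n → ℝ} {ζ : ℝ} (hν : StronglyRayleigh n B.card ν) (hcard : 0 < B.card)
    (hB : 0 < ν B) (he : e ∉ B)
    (hloc : ∀ g ∈ B, ν (insert e (B.erase g)) ≤ ζ * ν B)
    (hc : ∀ i, 0 < c i) (hc1 : ∀ i ∈ insert e B, c i = 1) :
    ∑ W ∈ powersetCard B.card univ with exchangeDegree B e W = 1, ν W * ∏ i ∈ W, c i ≤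
      ζ * B.card *
        ∑ W ∈ powersetCard B.card univ with exchangeDegree B e W = 2, ν W * ∏ i ∈ W, c i := by
  obtain ⟨hm, hd⟩ := monic_exchangePolynomial hB.ne' he hc1
  obtain ⟨hnn, hle⟩ := coeff_nonneg_and_coeff_one_le_of_roots_re_nonpos hm
    (by rw [hd]; exact even_two_mul _)
    (fun x hx => aeval_exchangePolynomial_ne_zero hν hB he hc hx)
  have hnext : (exchangePolynomial ν B e c).nextCoeff ≤ ζ * B.card := by
    rw [nextCoeff_of_natDegree_pos (by omega), hd, coeff_exchangePolynomial, div_le_iff₀ hB]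
    have hsub : (powersetCard B.card (univ : Finset (Fin n))).filter
        (fun W => exchangeDegree B e W = 2 * B.card - 1) ⊆
        B.image fun g => insert e (B.erase g) := by
      intro W hW
      rw [mem_filter, mem_powersetCard] at hW
      exact mem_image.2 (exists_eq_insert_erase_of_exchangeDegree hW.1.2 hW.2 hcard he)
    have hterm : ∀ W ∈ (powersetCard B.card (univ : Finset (Fin n))).filter
        (fun W => exchangeDegree B e W = 2 * B.card - 1), ν W * ∏ i ∈ W, c i ≤ ζ * ν B := by
      intro W hW
      obtain ⟨g, hg, rfl⟩ := mem_image.1 (hsub hW)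
      rw [prod_congr rfl (fun i hi => hc1 i (insert_subset_insert e (erase_subset g B) hi)),
        prod_const_one, mul_one]
      exact hloc g hg
    have hζ : 0 ≤ ζ * ν B := by
      obtain ⟨g, hg⟩ := card_pos.1 hcard
      refine (hν.1 _ ?_).trans (hloc g hg)
      rw [card_insert_of_notMem (fun h' => he (mem_of_mem_erase h')), card_erase_add_one hg]
    have hcd := (card_le_card hsub).trans card_image_le
    calc _ ≤ _ := sum_le_card_nsmul _ _ _ hterm
      _ ≤ B.card • (ζ * ν B) := nsmul_le_nsmul_left hζ hcd
      _ = _ := by rw [nsmul_eq_mul]; ring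
  have h := hle.trans (mul_le_mul_of_nonneg_left hnext (hnn 2))
  rw [coeff_exchangePolynomial, coeff_exchangePolynomial, div_mul_eq_mul_div,
    div_le_div_iff_of_pos_right hB] at h
  linarith

/-- The positivity assumption of `sum_exchangeDegree_one_le_of_pos` relaxed to nonnegativity. -/
theorem sum_exchangeDegree_one_le {ν : Finset (Fin n) → ℝ} {B : Finset (Fin n)} {e : Fin n}
    {c : Fin n → ℝ} {ζ : ℝ} (hν : StronglyRayleigh n B.card ν) (hcard : 0 < B.card)
    (hB : 0 < ν B) (he : e ∉ B)
    (hloc : ∀ g ∈ B, ν (insert e (B.erase g)) ≤ ζ * ν B)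
    (hc : ∀ i, 0 ≤ c i) (hc1 : ∀ i ∈ insert e B, c i = 1) :
    ∑ W ∈ powersetCard B.card univ with exchangeDegree B e W = 1, ν W * ∏ i ∈ W, c i ≤
      ζ * B.card *
        ∑ W ∈ powersetCard B.card univ with exchangeDegree B e W = 2, ν W * ∏ i ∈ W, c i := by
  let c' : ℝ → Fin n → ℝ := fun ε i => if i ∈ insert e B then 1 else c i + ε
  have hc0 : c' 0 = c := by
    ext i
    by_cases hi : i ∈ insert e B
    · simp only [c', if_pos hi, hc1 i hi]
    · simp only [c', if_neg hi, add_zero]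
  have hcont : ∀ i, Continuous fun ε => c' ε i := by
    intro i
    by_cases hi : i ∈ insert e B
    · simp only [c', if_pos hi]; fun_prop
    · simp only [c', if_neg hi]; fun_prop
  have hlim : ∀ j, Filter.Tendsto (fun ε => ∑ W ∈ powersetCard B.card univ with
      exchangeDegree B e W = j, ν W * ∏ i ∈ W, c' ε i) (nhdsWithin 0 (Set.Ioi 0))
      (nhds (∑ W ∈ powersetCard B.card univ with exchangeDegree B e W = j,
        ν W * ∏ i ∈ W, c i)) := by
    intro j
    have : Continuous fun ε => ∑ W ∈ powersetCard B.card univ with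
        exchangeDegree B e W = j, ν W * ∏ i ∈ W, c' ε i :=
      continuous_finsetSum _ fun W _ =>
        continuous_const.mul (continuous_finsetProd _ fun i _ => hcont i)
    have h := (this.tendsto 0).mono_left (nhdsWithin_le_nhds (s := Set.Ioi 0))
    rwa [hc0] at h
  refine le_of_tendsto_of_tendsto (hlim 1) ((hlim 2).const_mul _) ?_
  filter_upwards [self_mem_nhdsWithin] with ε hε
  refine sum_exchangeDegree_one_le_of_pos hν hcard hB he hloc (fun i => ?_) (fun i hi => ?_)
  · by_cases hi : i ∈ insert e B
    · simp only [c', if_pos hi]; norm_num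
    · simp only [c', if_neg hi]; exact add_pos_of_nonneg_of_pos (hc i) hε
  · simp only [c', if_pos hi]

/-- Total `a`-weighted mass of the sets `insert x W` with `W ⊆ T` of size `m`. -/
noncomputable def insertMass (ν : Finset (Fin n) → ℝ) (a : Fin n → ℝ) (T : Finset (Fin n)) (m : ℕ)
    (x : Fin n) : ℝ :=
  ∑ W ∈ powersetCard m T, (∏ i ∈ W, a i) * ν (insert x W)

theorem insertMass_le_mul_sum_insertMass {ν : Finset (Fin n) → ℝ} {B T : Finset (Fin n)}
    {e : Fin n} {a : Fin n → ℝ} {ζ : ℝ} {m : ℕ} (hm : B.card = m + 1)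
    (hν : StronglyRayleigh n (m + 1) ν) (hB : 0 < ν B) (he : e ∉ B) (hζ : 0 ≤ ζ)
    (hloc : ∀ g ∈ B, ν (insert e (B.erase g)) ≤ ζ * ν B)
    (ha : ∀ i, 0 ≤ a i) (hT : Disjoint T (insert e B)) :
    insertMass ν a T m e ≤ ζ * B.card * ∑ f ∈ B, insertMass ν a T m f := by
  let c : Fin n → ℝ := fun i => if i ∈ insert e B then 1 else if i ∈ T then a i else 0
  have hc : ∀ i, 0 ≤ c i := fun i => by
    simp only [c]
    split_ifs
    · exact zero_le_one
    · exact ha i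
    · exact le_rfl
  have hc1 : ∀ i ∈ insert e B, c i = 1 := fun i hi => by simp only [c, if_pos hi]
  have hcT : ∀ i ∈ T, c i = a i := fun i hi => by
    simp only [c, if_neg (disjoint_left.1 hT hi), if_pos hi]
  have hνB : StronglyRayleigh n B.card ν := hm ▸ hν
  have hterm : ∀ x ∈ insert e B, ∀ W ∈ powersetCard m T,
      (∏ i ∈ W, a i) * ν (insert x W) = ν (insert x W) * ∏ i ∈ insert x W, c i := by
    intro x hx W hW
    have hWT := (mem_powersetCard.1 hW).1
    rw [prod_insert (fun h => disjoint_left.1 hT (hWT h) hx), hc1 x hx, one_mul, mul_comm,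
      prod_congr rfl fun i hi => hcT i (hWT hi)]
  have hnonneg : ∀ W : Finset (Fin n), W.card = m + 1 → 0 ≤ ν W * ∏ i ∈ W, c i :=
    fun W hW => mul_nonneg (hν.1 W hW) (prod_nonneg fun i _ => hc i)
  have hinsert : ∀ x ∈ insert e B, ∀ W ∈ powersetCard m T, x ∉ W ∧ (insert x W).card = m + 1 := by
    intro x hx W hW
    rw [mem_powersetCard] at hW
    have hxW : x ∉ W := fun h => disjoint_left.1 hT (hW.1 h) hx
    exact ⟨hxW, by rw [card_insert_of_notMem hxW, hW.2]⟩
  have hlow : insertMass ν a T m e ≤ ∑ W ∈ powersetCard B.card univ with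
      exchangeDegree B e W = 1, ν W * ∏ i ∈ W, c i := by
    rw [insertMass, sum_congr rfl (hterm e (mem_insert_self e B))]
    rw [← sum_image (f := fun W => ν W * ∏ i ∈ W, c i) (g := insert e)]
    · refine sum_le_sum_of_subset_of_nonneg ?_ fun W hW _ => ?_
      · intro W' hW'
        obtain ⟨W, hW, rfl⟩ := mem_image.1 hW'
        rw [mem_filter, mem_powersetCard, hm]
        refine ⟨⟨subset_univ _, (hinsert e (mem_insert_self e B) W hW).2⟩, ?_⟩
        have hd : insert e W ∩ B = ∅ := by
          rw [insert_inter_of_notMem he, ← disjoint_iff_inter_eq_empty]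
          exact (hT.mono_left (mem_powersetCard.1 hW).1).mono_right (subset_insert e B)
        simp [exchangeDegree, hd]
      · rw [mem_filter, mem_powersetCard, hm] at hW
        exact hnonneg W hW.1.2
    · intro W₁ h₁ W₂ h₂ h
      rw [← erase_insert (hinsert e (mem_insert_self e B) W₁ h₁).1, h,
        erase_insert (hinsert e (mem_insert_self e B) W₂ h₂).1]
  have hupp : ∑ W ∈ powersetCard B.card univ with exchangeDegree B e W = 2,
      ν W * ∏ i ∈ W, c i ≤ ∑ f ∈ B, insertMass ν a T m f := by
    have hsum : ∑ f ∈ B, insertMass ν a T m f = ∑ p ∈ B ×ˢ powersetCard m T,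
        ν (insert p.1 p.2) * ∏ i ∈ insert p.1 p.2, c i := by
      rw [sum_product]
      exact sum_congr rfl fun f hf => sum_congr rfl (hterm f (mem_insert_of_mem hf))
    rw [hsum, ← sum_filter_ne_zero]
    have hex : ∀ W ∈ ((powersetCard B.card (univ : Finset (Fin n))).filter
        (fun W => exchangeDegree B e W = 2)).filter (fun W => ν W * ∏ i ∈ W, c i ≠ 0),
        ∃ p ∈ B ×ˢ powersetCard m T, insert p.1 p.2 = W := by
      intro W hW
      simp only [mem_filter, mem_powersetCard, subset_univ, true_and] at hW
      obtain ⟨⟨hWc, hWd⟩, hW0⟩ := hW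
      rw [exchangeDegree] at hWd
      have heW : e ∉ W := fun h => by rw [if_pos h] at hWd; omega
      rw [if_neg heW] at hWd
      obtain ⟨f, hf⟩ := card_eq_one.1 (show (W ∩ B).card = 1 by omega)
      have hfWB : f ∈ W ∩ B := hf ▸ mem_singleton_self f
      rw [mem_inter] at hfWB
      refine ⟨(f, W.erase f), mem_product.2 ⟨hfWB.2, mem_powersetCard.2 ⟨fun i hi => ?_, ?_⟩⟩,
        insert_erase hfWB.1⟩
      · rw [mem_erase] at hi
        by_contra hiT
        refine hW0 (mul_eq_zero_of_right _ (prod_eq_zero hi.2 ?_))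
        have hiB : i ∉ insert e B := fun h => by
          rcases mem_insert.1 h with rfl | h
          · exact heW hi.2
          · exact hi.1 (mem_singleton.1 (hf ▸ mem_inter.2 ⟨hi.2, h⟩))
        simp only [c, if_neg hiB, if_neg hiT]
      · rw [card_erase_of_mem hfWB.1]
        omega
    have : Nonempty (Fin n) := ⟨e⟩
    choose! q hq hqW using hex
    calc _ = ∑ p ∈ (((powersetCard B.card (univ : Finset (Fin n))).filter
          (fun W => exchangeDegree B e W = 2)).filter
            (fun W => ν W * ∏ i ∈ W, c i ≠ 0)).image q,
          ν (insert p.1 p.2) * ∏ i ∈ insert p.1 p.2, c i := by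
          rw [sum_image]
          · exact sum_congr rfl fun W hW => by rw [hqW W hW]
          · intro W₁ h₁ W₂ h₂ h
            rw [← hqW W₁ h₁, h, hqW W₂ h₂]
      _ ≤ _ := by
          refine sum_le_sum_of_subset_of_nonneg ?_ fun p hp _ => ?_
          · intro p hp
            obtain ⟨W, hW, rfl⟩ := mem_image.1 hp
            exact hq W hW
          · rw [mem_product] at hp
            exact hnonneg _ (hinsert p.1 (mem_insert_of_mem hp.1) p.2 hp.2).2
  calc _ ≤ _ := hlow
    _ ≤ _ := sum_exchangeDegree_one_le hνB (by omega) hB he hloc hc hc1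
    _ ≤ _ := mul_le_mul_of_nonneg_left hupp (by positivity)

/-- Replacing `e` by a suitable element of the local optimum `B` loses at most a factor
`(ζ * ℓ) ^ 2`, where `ℓ = m + 1`. -/
theorem exists_insertMass_le {ν : Finset (Fin n) → ℝ} {B T : Finset (Fin n)}
    {e : Fin n} {a : Fin n → ℝ} {ζ : ℝ} {m : ℕ} (hm : B.card = m + 1)
    (hν : StronglyRayleigh n (m + 1) ν) (hB : 0 < ν B) (he : e ∉ B) (hζ : 1 ≤ ζ)
    (hloc : ∀ g ∈ B, ν (insert e (B.erase g)) ≤ ζ * ν B)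
    (ha : ∀ i, 0 ≤ a i) (hT : Disjoint T (insert e B)) :
    ∃ f ∈ B, insertMass ν a T m e ≤ (ζ * (m + 1)) ^ 2 * insertMass ν a T m f := by
  have hBne : B.Nonempty := card_pos.1 (by omega)
  obtain ⟨f, hf, hmax⟩ := B.exists_max_image (insertMass ν a T m) hBne
  refine ⟨f, hf, ?_⟩
  have hfnn : 0 ≤ insertMass ν a T m f := by
    refine sum_nonneg fun W hW => mul_nonneg (prod_nonneg fun i _ => ha i) (hν.1 _ ?_)
    rw [mem_powersetCard] at hW
    rw [card_insert_of_notMem fun h => disjoint_left.1 hT (hW.1 h) (mem_insert_of_mem hf), hW.2]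
  calc _ ≤ _ := insertMass_le_mul_sum_insertMass hm hν hB he (by linarith) hloc ha hT
    _ ≤ ζ * B.card * (B.card • insertMass ν a T m f) :=
      mul_le_mul_of_nonneg_left (sum_le_card_nsmul _ _ _ hmax) (by positivity)
    _ = ζ * ((m + 1) ^ 2 * insertMass ν a T m f) := by
      rw [nsmul_eq_mul, hm]; push_cast; ring
    _ ≤ ζ ^ 2 * ((m + 1) ^ 2 * insertMass ν a T m f) :=
      mul_le_mul_of_nonneg_right (by nlinarith) (by positivity)
    _ = _ := by ring

theorem sum_powersetCard_succ_insert {α M : Type*} [DecidableEq α] [AddCommMonoid M]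
    {x : α} {T : Finset α} (hx : x ∉ T) (m : ℕ) (F : Finset α → M) :
    ∑ W ∈ powersetCard (m + 1) (insert x T), F W =
      ∑ W ∈ powersetCard (m + 1) T, F W + ∑ W ∈ powersetCard m T, F (insert x W) := by
  have hxW : ∀ k, ∀ W ∈ powersetCard k T, x ∉ W := fun k W hW h =>
    hx ((mem_powersetCard.1 hW).1 h)
  rw [powersetCard_succ_insert hx, sum_union, sum_image]
  · intro W₁ h₁ W₂ h₂ h
    rw [← erase_insert (hxW m W₁ h₁), h, erase_insert (hxW m W₂ h₂)]
  · refine disjoint_left.2 fun W hW h => ?_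
    obtain ⟨W', _, rfl⟩ := mem_image.1 h
    exact hxW _ _ hW (mem_insert_self x W')

/-- If `S` meets `V` in at most `kV` elements, one of which is not in the coreset, then some part
of the coreset is disjoint from `S`. -/
theorem PeelingCoreset.exists_disjoint_localOpt {ℓ kV : ℕ} {ζ : ℝ} {ν : Finset (Fin n) → ℝ}
    {V U S : Finset (Fin n)} (hU : PeelingCoreset n ℓ ζ ν V kV U) {e : Fin n}
    (he : e ∈ S ∩ V) (heU : e ∉ U) (hSV : (S ∩ V).card ≤ kV) :
    ∃ B ⊆ U, B.card = ℓ ∧ Disjoint B S ∧ ∀ g ∈ B, ν (insert e (B.erase g)) ≤ ζ * ν B := by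
  obtain ⟨Us, hUs, rfl⟩ := hU
  have hsub : ∀ i, Us i ⊆ univ.biUnion Us := fun i => subset_biUnion_of_mem Us (mem_univ i)
  have hlt : ∀ i j, i < j → Disjoint (Us i) (Us j) := fun i j hij =>
    disjoint_left.2 fun x hi hj => (mem_sdiff.1 ((hUs j).1 hj)).2
      (mem_biUnion.2 ⟨i, mem_filter.2 ⟨mem_univ i, hij⟩, hi⟩)
  obtain ⟨i, hi⟩ : ∃ i, Disjoint (Us i) S := by
    by_contra! h
    choose s hs using fun i => not_disjoint_iff.1 (h i)
    have hinj : Function.Injective s := by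
      intro i j hij
      by_contra hne
      rcases lt_or_gt_of_ne hne with h' | h'
      · exact disjoint_left.1 (hlt i j h') (hs i).1 (hij ▸ (hs j).1)
      · exact disjoint_left.1 (hlt j i h') (hs j).1 (hij ▸ (hs i).1)
    have hcard := card_le_card_of_injOn (s := univ) (t := (S ∩ V).erase e) s
      (fun i _ => mem_erase.2 ⟨fun h' => heU (h' ▸ hsub i (hs i).1),
        mem_inter.2 ⟨(hs i).2, (mem_sdiff.1 ((hUs i).1 (hs i).1)).1⟩⟩) hinj.injOn
    rw [card_univ, Fintype.card_fin] at hcard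
    have := card_erase_lt_of_mem he
    omega
  refine ⟨Us i, hsub i, (hUs i).2.1, hi, fun g hg => (hUs i).2.2 g hg e ?_⟩
  refine mem_sdiff.2 ⟨mem_sdiff.2 ⟨(mem_inter.1 he).2, fun h => heU ?_⟩,
    fun h => heU (hsub i h)⟩
  obtain ⟨j, _, hj⟩ := mem_biUnion.1 h
  exact hsub j hj

end Exchange

/-- the peeling coreset `U` allows a repetition-free exchange: for any
`k`-set `S` with `|S ∩ V| ≤ kV` and any `e ∈ S ∩ V`, some `f ∈ U ∖ (S∖{e})` satisfies
`μ̃(S) ≤ μ̃((S∖{e})∪{f})` where `μ̃(S) = Σ_{W⊆S, |W|=ℓ} (ζℓ)^{2|W∩U|}·ν(W)`, and the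
exchanged set still meets `V` in at most `kV` elements. -/
theorem stmt5 (n ℓ k kV : ℕ) (hℓ1 : 1 ≤ ℓ) (hℓk : ℓ ≤ k) (hkV : 1 ≤ kV)
    (ν : Finset (Fin n) → ℝ) (hν : StronglyRayleigh n ℓ ν)
    (hfull : ∀ S : Finset (Fin n), S.card = ℓ → 0 < ν S)
    (ζ : ℝ) (hζ : 1 ≤ ζ)
    (V U : Finset (Fin n)) (hU : PeelingCoreset n ℓ ζ ν V kV U)
    (S : Finset (Fin n)) (hS : S.card = k) (hSV : (S ∩ V).card ≤ kV)
    (e : Fin n) (he : e ∈ S ∩ V) :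
    ∃ f ∈ U \ (S.erase e),
      (∑ W ∈ Finset.powersetCard ℓ S,
          (ζ * ℓ) ^ (2 * (W ∩ U).card) * ν W) ≤
      (∑ W ∈ Finset.powersetCard ℓ (insert f (S.erase e)),
          (ζ * ℓ) ^ (2 * (W ∩ U).card) * ν W) ∧
      ((insert f (S.erase e)) ∩ V).card ≤ kV := by
  have heS := (mem_inter.1 he).1
  by_cases heU : e ∈ U
  · refine ⟨e, mem_sdiff.2 ⟨heU, notMem_erase e S⟩, ?_⟩
    rw [insert_erase heS]
    exact ⟨le_rfl, hSV⟩
  obtain ⟨B, hBU, hBc, hBS, hloc⟩ := hU.exists_disjoint_localOpt he heU hSV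
  obtain ⟨m, rfl⟩ : ∃ m, ℓ = m + 1 := ⟨ℓ - 1, by omega⟩
  have heB : e ∉ B := fun h => heU (hBU h)
  obtain ⟨f, hf, hle⟩ := exists_insertMass_le (T := S.erase e)
    (a := fun i => if i ∈ U then (ζ * ((m + 1 : ℕ) : ℝ)) ^ 2 else 1) hBc hν
    (hfull B hBc) heB hζ hloc (fun i => by split_ifs <;> positivity)
    (disjoint_insert_right.2 ⟨notMem_erase e S, (hBS.mono_right (erase_subset e S)).symm⟩)
  have hfS : f ∉ S := disjoint_left.1 hBS hf
  have hfT : f ∉ S.erase e := fun h => hfS (mem_of_mem_erase h)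
  have hweight : ∀ W : Finset (Fin n), (∏ i ∈ W, if i ∈ U then (ζ * ((m + 1 : ℕ) : ℝ)) ^ 2 else 1) =
      (ζ * ((m + 1 : ℕ) : ℝ)) ^ (2 * (W ∩ U).card) := fun W => by
    rw [prod_ite_mem, prod_const, pow_mul]
  refine ⟨f, mem_sdiff.2 ⟨hBU hf, hfT⟩, ?_, ?_⟩
  · have hsplit := sum_powersetCard_succ_insert (notMem_erase e S) m
      (fun W => (ζ * ((m + 1 : ℕ) : ℝ)) ^ (2 * (W ∩ U).card) * ν W)
    rw [insert_erase heS] at hsplit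
    rw [hsplit, sum_powersetCard_succ_insert hfT]
    refine add_le_add_right ?_ _
    simp only [insertMass, hweight] at hle
    simp only [insert_inter_of_notMem heU]
    refine hle.trans_eq ?_
    rw [mul_sum]
    refine sum_congr rfl fun W hW => ?_
    have hfW : f ∉ W ∩ U := fun h => hfT ((mem_powersetCard.1 hW).1 (mem_inter.1 h).1)
    rw [insert_inter_of_mem (hBU hf), card_insert_of_notMem hfW]
    push_cast
    ring
  · have hsub : insert f (S.erase e) ∩ V ⊆ insert f ((S ∩ V).erase e) := fun x hx => by
      simp only [mem_inter, mem_insert, mem_erase] at hx ⊢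
      tauto
    have h1 := (card_le_card hsub).trans (card_insert_le _ _)
    rw [card_erase_add_one he] at h1
    exact h1.trans hSV
end
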